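/- Every centered SC-semigroup (μ_t)_{t≥0} associated with (T_t)_{t≥0} satisfying ∫_H ‖x‖² μ_t(dx) < ∞ for all t ≥ 0 is differentiable if and only if every locally square integrable entrance path for (T_t)_{t≥0} is closable. -/

import Mathlib

open MeasureTheory Real Filter
open scoped ENNReal InnerProductSpace NNReal

noncomputable section

/-- A strongly continuous semigroup of bounded linear operators on `H`. -/
def IsC0 {H : Type*} [NormedAddCommGroup H] [NormedSpace ℝ H]
    (T : ℝ → H →L[ℝ] H) : Prop :=
  T 0 = ContinuousLinearMap.id ℝ H ∧
  (∀ s t : ℝ, 0 ≤ s → 0 ≤ t → T (s + t) = (T s).comp (T t)) ∧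
  ∀ x : H, ContinuousOn (fun t => T t x) (Set.Ici 0)

/-- An entrance path for `(T_t)` (normalized to vanish on `(-∞,0]`). -/
def IsEntrance {H : Type*} [NormedAddCommGroup H] [NormedSpace ℝ H]
    (T : ℝ → H →L[ℝ] H) (x : ℝ → H) : Prop :=
  (∀ s : ℝ, s ≤ 0 → x s = 0) ∧ ∀ r t : ℝ, 0 < r → 0 < t → x (r + t) = T t (x r)

/-- Membership in the entrance space `H̃`: a locally square integrable entrance path. -/
def MemHt {H : Type*} [NormedAddCommGroup H] [NormedSpace ℝ H]
    (T : ℝ → H →L[ℝ] H) (x : ℝ → H) : Prop :=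
  IsEntrance T x ∧ ∃ l > (0:ℝ), ∫⁻ s in Set.Ioo 0 l, (‖x s‖₊ : ℝ≥0∞) ^ 2 < ⊤

/-- Convolution of two measures on an additive measurable group. -/
def mconv {G : Type*} [MeasurableSpace G] [Add G] (μ ν : Measure G) : Measure G :=
  (μ.prod ν).map fun p => p.1 + p.2

/-- A skew convolution semigroup (SC-semigroup) associated with `(T_t)`. -/
def IsSC {H : Type*} [NormedAddCommGroup H] [NormedSpace ℝ H] [MeasurableSpace H]
    (T : ℝ → H →L[ℝ] H) (μ : ℝ → Measure H) : Prop :=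
  (∀ t : ℝ, 0 ≤ t → IsProbabilityMeasure (μ t)) ∧
  ∀ r t : ℝ, 0 ≤ r → 0 ≤ t → μ (r + t) = mconv ((μ r).map (T t)) (μ t)

/-- The characteristic functional `μ̂(a) = ∫_H e^{i⟨x,a⟩} μ(dx)`. -/
def charFn {H : Type*} [NormedAddCommGroup H] [InnerProductSpace ℝ H] [MeasurableSpace H]
    (μ : Measure H) (a : H) : ℂ :=
  ∫ x, Complex.exp ((⟪x, a⟫_ℝ : ℂ) * Complex.I) ∂μ

/-- `n`-fold convolution power of a measure. -/
def convPow {G : Type*} [MeasurableSpace G] [AddMonoid G] (ν : Measure G) : ℕ → Measure G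
  | 0 => Measure.dirac 0
  | n + 1 => mconv (convPow ν n) ν

/-- Infinite divisibility. -/
def IsInfDiv {G : Type*} [MeasurableSpace G] [AddMonoid G] (μ : Measure G) : Prop :=
  ∀ n : ℕ, 1 ≤ n → ∃ ν : Measure G, IsProbabilityMeasure ν ∧ μ = convPow ν n

/-- A *differentiable* SC-semigroup: one of the form (3.2), i.e.
`μ̂_t(a) = exp{∫_0^t log ν̂₀(T_s^* a) ds}` for a centered infinitely divisible
probability measure `ν₀` on `H` with finite second moment. -/
def IsDiffSC {H : Type*} [NormedAddCommGroup H] [InnerProductSpace ℝ H] [CompleteSpace H]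
    [MeasurableSpace H]
    (T : ℝ → H →L[ℝ] H) (μ : ℝ → Measure H) : Prop :=
  ∃ (ν₀ : Measure H) (L : H → ℂ),
    IsProbabilityMeasure ν₀ ∧ (∫ x, x ∂ν₀ = 0) ∧
    (∫⁻ x, (‖x‖₊ : ℝ≥0∞) ^ 2 ∂ν₀ < ⊤) ∧ IsInfDiv ν₀ ∧
    Continuous L ∧ L 0 = 0 ∧ (∀ a : H, Complex.exp (L a) = charFn ν₀ a) ∧
    ∀ t : ℝ, 0 ≤ t → ∀ a : H, charFn (μ t) a =
      Complex.exp (∫ s in Set.Ioo 0 t, L ((ContinuousLinearMap.adjoint (T s)) a))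

open scoped Topology

section CharFunEstimates

lemma norm_exp_mul_I_sub_one_sub_le (y : ℝ) :
    ‖Complex.exp (y * Complex.I) - 1 - y * Complex.I‖ ≤ 3 * y ^ 2 := by
  have hn : ‖(y : ℂ) * Complex.I‖ = |y| := by simp
  rcases le_total |y| 1 with h | h
  · have := Complex.norm_exp_sub_one_sub_id_le (x := y * Complex.I) (by rwa [hn])
    rw [hn, sq_abs] at this
    nlinarith [sq_nonneg y]
  · calc ‖Complex.exp (y * Complex.I) - 1 - y * Complex.I‖
        ≤ ‖Complex.exp (y * Complex.I)‖ + ‖(1 : ℂ)‖ + ‖(y : ℂ) * Complex.I‖ :=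
          (norm_sub_le _ _).trans (by gcongr; exact norm_sub_le _ _)
      _ = 2 + |y| := by rw [Complex.norm_exp_ofReal_mul_I, hn, norm_one]; ring
      _ ≤ 3 * y ^ 2 := by rw [← sq_abs]; nlinarith

lemma norm_exp_mul_I_sub_exp_mul_I_sub_le (y z : ℝ) :
    ‖Complex.exp (y * Complex.I) - Complex.exp (z * Complex.I) - (y - z : ℝ) * Complex.I‖ ≤
      3 * (y - z) ^ 2 + |z| * |y - z| := by
  have h : Complex.exp (y * Complex.I) - Complex.exp (z * Complex.I) - (y - z : ℝ) * Complex.I =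
      Complex.exp (z * Complex.I) *
        (Complex.exp ((y - z : ℝ) * Complex.I) - 1 - (y - z : ℝ) * Complex.I) +
      (Complex.exp (z * Complex.I) - 1) * ((y - z : ℝ) * Complex.I) := by
    have : Complex.exp (y * Complex.I) =
        Complex.exp (z * Complex.I) * Complex.exp ((y - z : ℝ) * Complex.I) := by
      rw [← Complex.exp_add]; congr 1; push_cast; ring
    rw [this]; ring
  rw [h]
  refine (norm_add_le _ _).trans (add_le_add ?_ ?_)
  · rw [norm_mul, Complex.norm_exp_ofReal_mul_I, one_mul]
    exact norm_exp_mul_I_sub_one_sub_le _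
  · rw [norm_mul]
    refine mul_le_mul ?_ (by rw [norm_mul, Complex.norm_I, mul_one, Complex.norm_real,
      Real.norm_eq_abs]) (norm_nonneg _) (abs_nonneg _)
    rw [mul_comm (z : ℂ)]
    exact Real.norm_exp_I_mul_ofReal_sub_one_le

variable {H : Type*} [NormedAddCommGroup H] [MeasurableSpace H] [BorelSpace H]
  [SecondCountableTopology H]

lemma memLp_id_of_lintegral_sq_lt_top {ν : Measure H}
    (hm : ∫⁻ x, (‖x‖₊ : ℝ≥0∞) ^ 2 ∂ν < ⊤) : MemLp (fun x : H => x) 2 ν := by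
  refine ⟨measurable_id.aestronglyMeasurable, ?_⟩
  rw [eLpNorm_lt_top_iff_lintegral_rpow_enorm_lt_top (by norm_num) (by norm_num)]
  simpa [enorm_eq_nnnorm] using hm

lemma integrable_id_of_lintegral_sq_lt_top {ν : Measure H} [IsFiniteMeasure ν]
    (hm : ∫⁻ x, (‖x‖₊ : ℝ≥0∞) ^ 2 ∂ν < ⊤) : Integrable (fun x : H => x) ν :=
  (memLp_id_of_lintegral_sq_lt_top hm).integrable (by norm_num)

lemma integrable_norm_sq_of_lintegral_sq_lt_top {ν : Measure H}
    (hm : ∫⁻ x, (‖x‖₊ : ℝ≥0∞) ^ 2 ∂ν < ⊤) : Integrable (fun x : H => ‖x‖ ^ 2) ν :=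
  (memLp_id_of_lintegral_sq_lt_top hm).integrable_norm_pow (by norm_num)

lemma integral_norm_sq_eq_toReal (ν : Measure H) :
    ∫ x, ‖x‖ ^ 2 ∂ν = (∫⁻ x, (‖x‖₊ : ℝ≥0∞) ^ 2 ∂ν).toReal := by
  rw [integral_eq_lintegral_of_nonneg_ae (ae_of_all _ fun x => by positivity)
    (by fun_prop)]
  congr with x
  rw [← enorm_eq_nnnorm, ← ofReal_norm, ← ENNReal.ofReal_pow (norm_nonneg _)]

variable [InnerProductSpace ℝ H]

lemma integrable_exp_inner_mul_I (ν : Measure H) [IsFiniteMeasure ν] (a : H) :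
    Integrable (fun x : H => Complex.exp ((⟪x, a⟫_ℝ : ℂ) * Complex.I)) ν :=
  Integrable.of_bound (by fun_prop) 1
    (ae_of_all _ fun x => (Complex.norm_exp_ofReal_mul_I _).le)

/-- Second order estimate for increments of characteristic functions. -/
lemma norm_charFun_sub_charFun_sub_le [CompleteSpace H] (ν : Measure H) [IsFiniteMeasure ν] {K : ℝ}
    (hK : 0 ≤ K) (hm : ∫⁻ x, (‖x‖₊ : ℝ≥0∞) ^ 2 ∂ν ≤ ENNReal.ofReal K) (a b : H) :
    ‖charFun ν a - charFun ν b - (⟪∫ x, x ∂ν, a - b⟫_ℝ : ℝ) * Complex.I‖ ≤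
      K * (3 * ‖a - b‖ ^ 2 + ‖b‖ * ‖a - b‖) := by
  have hm' := hm.trans_lt ENNReal.ofReal_lt_top
  have hid := integrable_id_of_lintegral_sq_lt_top hm'
  have hsq := integrable_norm_sq_of_lintegral_sq_lt_top hm'
  have hin : Integrable (fun x : H => ((⟪x, a⟫_ℝ - ⟪x, b⟫_ℝ : ℝ) : ℂ) * Complex.I) ν := by
    simp_rw [← inner_sub_right]
    exact ((hid.inner_const (a - b)).ofReal).mul_const _
  have hmean : ((⟪∫ x, x ∂ν, a - b⟫_ℝ : ℝ) : ℂ) * Complex.I =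
      ∫ x, ((⟪x, a⟫_ℝ - ⟪x, b⟫_ℝ : ℝ) : ℂ) * Complex.I ∂ν := by
    rw [integral_mul_const]
    congr 1
    simp_rw [← inner_sub_right]
    rw [integral_complex_ofReal, real_inner_comm, ← integral_inner hid]
    simp_rw [real_inner_comm]
  have hd : Integrable (fun x : H => Complex.exp ((⟪x, a⟫_ℝ : ℂ) * Complex.I) -
      Complex.exp ((⟪x, b⟫_ℝ : ℂ) * Complex.I)) ν :=
    (integrable_exp_inner_mul_I ν a).sub (integrable_exp_inner_mul_I ν b)
  rw [charFun_apply, charFun_apply, hmean,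
    ← integral_sub (integrable_exp_inner_mul_I ν a) (integrable_exp_inner_mul_I ν b),
    ← integral_sub hd hin]
  refine (norm_integral_le_of_norm_le
    (hsq.mul_const (3 * ‖a - b‖ ^ 2 + ‖b‖ * ‖a - b‖)) (ae_of_all _ fun x => ?_)).trans ?_
  · refine (norm_exp_mul_I_sub_exp_mul_I_sub_le _ _).trans ?_
    rw [← inner_sub_right]
    have h1 := abs_real_inner_le_norm x (a - b)
    have h2 := abs_real_inner_le_norm x b
    have h3 : ⟪x, a - b⟫_ℝ ^ 2 ≤ (‖x‖ * ‖a - b‖) ^ 2 := by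
      rw [← sq_abs]; gcongr
    have h4 : |⟪x, b⟫_ℝ| * |⟪x, a - b⟫_ℝ| ≤ (‖x‖ * ‖b‖) * (‖x‖ * ‖a - b‖) := by gcongr
    nlinarith
  · rw [integral_mul_const, integral_norm_sq_eq_toReal]
    gcongr
    exact ENNReal.toReal_le_of_le_ofReal hK hm

lemma norm_charFun_sub_charFun_le [CompleteSpace H] (ν : Measure H) [IsFiniteMeasure ν] {K : ℝ}
    (hK : 0 ≤ K) (h0 : ∫ x, x ∂ν = 0)
    (hm : ∫⁻ x, (‖x‖₊ : ℝ≥0∞) ^ 2 ∂ν ≤ ENNReal.ofReal K) (a b : H) :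
    ‖charFun ν a - charFun ν b‖ ≤ K * (3 * ‖a - b‖ ^ 2 + ‖b‖ * ‖a - b‖) := by
  simpa [h0] using norm_charFun_sub_charFun_sub_le ν hK hm a b

lemma norm_charFun_sub_one_le [CompleteSpace H] (ν : Measure H) [IsProbabilityMeasure ν] {K : ℝ}
    (hK : 0 ≤ K) (h0 : ∫ x, x ∂ν = 0)
    (hm : ∫⁻ x, (‖x‖₊ : ℝ≥0∞) ^ 2 ∂ν ≤ ENNReal.ofReal K) (a : H) :
    ‖charFun ν a - 1‖ ≤ 3 * K * ‖a‖ ^ 2 := by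
  have := norm_charFun_sub_charFun_le ν hK h0 hm a 0
  simp only [charFun_zero, probReal_univ, Complex.ofReal_one, sub_zero, norm_zero, zero_mul,
    add_zero] at this
  linarith

/-- A measure whose characteristic function is quadratically close to `1` is centered. -/
lemma integral_id_eq_zero_of_norm_charFun_sub_one_le [CompleteSpace H] (ν : Measure H)
    [IsProbabilityMeasure ν] {K C : ℝ} (hK : 0 ≤ K)
    (hm : ∫⁻ x, (‖x‖₊ : ℝ≥0∞) ^ 2 ∂ν ≤ ENNReal.ofReal K)
    (h : ∀ a, ‖charFun ν a - 1‖ ≤ C * ‖a‖ ^ 2) : ∫ x, x ∂ν = 0 := by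
  set m := ∫ x, x ∂ν with hmdef
  have key : ∀ ε : ℝ, 0 < ε → ‖m‖ ^ 2 ≤ ε * ((3 * K + C) * ‖m‖ ^ 2) := by
    intro ε hε
    have h1 := norm_charFun_sub_charFun_sub_le ν hK hm (ε • m) 0
    have h2 := h (ε • m)
    simp only [charFun_zero, probReal_univ, Complex.ofReal_one, sub_zero, norm_zero, zero_mul,
      add_zero] at h1
    have h3 : ‖((⟪m, ε • m⟫_ℝ : ℝ) : ℂ) * Complex.I‖ = ε * ‖m‖ ^ 2 := by
      rw [norm_mul, Complex.norm_I, mul_one, Complex.norm_real, inner_smul_right,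
        real_inner_self_eq_norm_sq, Real.norm_of_nonneg (by positivity)]
    have h4 : ‖((⟪m, ε • m⟫_ℝ : ℝ) : ℂ) * Complex.I‖ ≤
        C * ‖ε • m‖ ^ 2 + K * (3 * ‖ε • m‖ ^ 2) := by
      have : ((⟪m, ε • m⟫_ℝ : ℝ) : ℂ) * Complex.I = (charFun ν (ε • m) - 1) -
        (charFun ν (ε • m) - 1 - ((⟪m, ε • m⟫_ℝ : ℝ) : ℂ) * Complex.I) := by ring
      rw [this]
      exact (norm_sub_le _ _).trans (add_le_add h2 h1)
    rw [h3, norm_smul, Real.norm_of_nonneg hε.le, mul_pow] at h4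
    have h5 : ε * ‖m‖ ^ 2 ≤ ε * (ε * ((3 * K + C) * ‖m‖ ^ 2)) := by linarith
    exact le_of_mul_le_mul_left h5 hε
  have hlim : Tendsto (fun ε : ℝ => ε * ((3 * K + C) * ‖m‖ ^ 2)) (𝓝[>] 0)
      (𝓝 (0 * ((3 * K + C) * ‖m‖ ^ 2))) :=
    (tendsto_nhdsWithin_of_tendsto_nhds tendsto_id).mul_const _
  have h6 : ‖m‖ ^ 2 ≤ 0 := by
    have := ge_of_tendsto hlim (eventually_nhdsWithin_of_forall fun ε hε => key ε hε)
    simpa using this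
  have : ‖m‖ = 0 := by nlinarith [norm_nonneg m]
  exact norm_eq_zero.1 this

end CharFunEstimates

section WeakLimits

variable {H : Type*} [NormedAddCommGroup H]

lemma measurable_of_measurableSet_preimage_closedBall {Ω X : Type*} [MeasurableSpace Ω]
    [PseudoMetricSpace X] [SecondCountableTopology X] [MeasurableSpace X] [BorelSpace X]
    {f : Ω → X} (h : ∀ x r, MeasurableSet (f ⁻¹' Metric.closedBall x r)) : Measurable f := by
  refine measurable_of_isOpen fun s hs => ?_
  have hr : ∀ x : s, ∃ r > 0, Metric.closedBall (x : X) r ⊆ s := fun x =>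
    Metric.nhds_basis_closedBall.mem_iff.1 (hs.mem_nhds x.2)
  choose r hr0 hrs using hr
  obtain ⟨C, hC, hCU⟩ := TopologicalSpace.isOpen_iUnion_countable
    (fun x : s => Metric.ball (x : X) (r x)) (fun x => Metric.isOpen_ball)
  have hs' : s = ⋃ x ∈ C, Metric.closedBall (x : X) (r x) := by
    apply Set.Subset.antisymm
    · intro y hy
      have : y ∈ ⋃ x ∈ C, Metric.ball (x : X) (r x) := by
        rw [hCU]
        exact Set.mem_iUnion.2 ⟨⟨y, hy⟩, Metric.mem_ball_self (hr0 _)⟩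
      simp only [Set.mem_iUnion] at this ⊢
      obtain ⟨x, hx, hxy⟩ := this
      exact ⟨x, hx, Metric.ball_subset_closedBall hxy⟩
    · simp only [Set.iUnion_subset_iff]
      exact fun x _ => hrs x
  rw [hs', Set.preimage_iUnion₂]
  exact MeasurableSet.biUnion hC fun x _ => h _ _

/-- Bounded functions of finitely many coordinates that increase to the squared norm. -/
def sqNormApprox (d : ℕ → H) (N : ℕ) (φ : H → ℝ) : ℝ :=
  min N (max 0 ((Finset.range (N + 1)).sup' ⟨0, by simp⟩ fun k => 2 * φ (d k) - ‖d k‖ ^ 2))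

lemma sqNormApprox_nonneg (d : ℕ → H) (N : ℕ) (φ : H → ℝ) : 0 ≤ sqNormApprox d N φ :=
  le_min (Nat.cast_nonneg N) (le_max_left _ _)

lemma sqNormApprox_le_natCast (d : ℕ → H) (N : ℕ) (φ : H → ℝ) : sqNormApprox d N φ ≤ N :=
  min_le_left _ _

variable [InnerProductSpace ℝ H]

lemma sqNormApprox_inner_le (d : ℕ → H) (N : ℕ) (x : H) :
    sqNormApprox d N (fun a => ⟪x, a⟫_ℝ) ≤ ‖x‖ ^ 2 := by
  refine (min_le_right _ _).trans (max_le (by positivity) (Finset.sup'_le _ _ fun k _ => ?_))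
  have := norm_sub_sq_real x (d k)
  nlinarith [sq_nonneg ‖x - d k‖]

lemma tendsto_sqNormApprox {d : ℕ → H} (hd : DenseRange d) (x : H) :
    Tendsto (fun N => sqNormApprox d N (fun a => ⟪x, a⟫_ℝ)) atTop (𝓝 (‖x‖ ^ 2)) := by
  rw [Metric.tendsto_atTop]
  intro ε hε
  obtain ⟨k, hk⟩ := hd.exists_dist_lt x (Real.sqrt_pos.2 hε)
  obtain ⟨M, hM⟩ := exists_nat_ge (‖x‖ ^ 2)
  refine ⟨max k M, fun N hN => ?_⟩
  have h1 := sqNormApprox_inner_le d N x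
  have hkN : k ≤ N := (le_max_left _ _).trans hN
  have hMN : (M : ℝ) ≤ N := by exact_mod_cast (le_max_right _ _).trans hN
  rw [dist_eq_norm] at hk
  have hk2 : ‖x - d k‖ ^ 2 < ε := by
    have := pow_lt_pow_left₀ hk (norm_nonneg _) two_ne_zero
    rwa [Real.sq_sqrt hε.le] at this
  have hx := norm_sub_sq_real x (d k)
  have h2 : ‖x‖ ^ 2 - ‖x - d k‖ ^ 2 ≤ sqNormApprox d N (fun a => ⟪x, a⟫_ℝ) := by
    refine le_min ?_ (le_max_of_le_right ?_)
    · nlinarith [sq_nonneg ‖x - d k‖]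
    · refine le_trans ?_ (Finset.le_sup' _ (Finset.mem_range.2 (Nat.lt_succ_of_le hkN)))
      linarith
  rw [Real.dist_eq, abs_lt]
  constructor <;> linarith

variable [CompleteSpace H] [MeasurableSpace H] [BorelSpace H] [SecondCountableTopology H]

/-- A family of probability measures with uniformly bounded second moments has a limit point in
the sense of pointwise convergence of characteristic functions. -/
lemma exists_charFun_limit {ι : Type*} (U : Ultrafilter ι) (ν : ι → Measure H)
    (hν : ∀ i, IsProbabilityMeasure (ν i)) {K : ℝ} (hK : 0 ≤ K)
    (hm : ∀ i, ∫⁻ x, (‖x‖₊ : ℝ≥0∞) ^ 2 ∂(ν i) ≤ ENNReal.ofReal K) :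
    ∃ ρ : Measure H, IsProbabilityMeasure ρ ∧
      ∫⁻ x, (‖x‖₊ : ℝ≥0∞) ^ 2 ∂ρ ≤ ENNReal.ofReal K ∧
      ∀ a, Tendsto (fun i => charFun (ν i) a) U (𝓝 (charFun ρ a)) := by
  let _ : MeasurableSpace (WeakDual ℝ H) := borel _
  have _ : BorelSpace (WeakDual ℝ H) := ⟨rfl⟩
  let e : H → WeakDual ℝ H := fun x => StrongDual.toWeakDual (InnerProductSpace.toDual ℝ H x)
  have e_apply : ∀ x a, e x a = ⟪x, a⟫_ℝ := fun x a => by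
    simp only [e, StrongDual.toWeakDual_apply]
    exact InnerProductSpace.toDual_apply_apply
  have he : Continuous e :=
    NormedSpace.Dual.toWeakDual_continuous.comp (InnerProductSpace.toDual ℝ H).continuous
  let R : WeakDual ℝ H → H := fun φ =>
    (InnerProductSpace.toDual ℝ H).symm (WeakDual.toStrongDual φ)
  have hRe : ∀ φ, e (R φ) = φ := fun φ => by simp [e, R]
  have hR : Measurable R := by
    refine measurable_of_measurableSet_preimage_closedBall fun x r => ?_
    convert! (WeakDual.isClosed_closedBall (InnerProductSpace.toDual ℝ H x) r).measurableSet
      using 1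
    ext φ
    simp only [R, Set.mem_preimage, mem_closedBall_iff_norm]
    rw [← (InnerProductSpace.toDual ℝ H).norm_map]
    simp
  let P : ι → ProbabilityMeasure (WeakDual ℝ H) := fun i =>
    ⟨(ν i).map e, haveI := hν i; Measure.isProbabilityMeasure_map he.aemeasurable⟩
  have hcpt : IsCompact (closure (Set.range P)) := by
    refine isCompact_closure_of_isTightMeasureSet ?_
    rw [isTightMeasureSet_iff_exists_isCompact_measure_compl_le]
    intro ε hε
    obtain ⟨r, hr0, hr⟩ : ∃ r : ℝ≥0, 0 < r ∧ ENNReal.ofReal K ≤ ε * (r : ℝ≥0∞) ^ 2 := by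
      obtain ⟨n, hn⟩ := ENNReal.exists_nat_mul_gt hε.ne' (ENNReal.ofReal_ne_top (r := K))
      refine ⟨n + 1, by positivity, hn.le.trans ?_⟩
      rw [mul_comm]
      gcongr
      norm_cast
      nlinarith
    refine ⟨WeakDual.toStrongDual ⁻¹' Metric.closedBall 0 r,
      WeakDual.isCompact_closedBall 0 r, ?_⟩
    rintro _ ⟨_, ⟨i, rfl⟩, rfl⟩
    have hmeas := (WeakDual.isClosed_closedBall (0 : StrongDual ℝ H) r).measurableSet
    change ((ν i).map e) _ ≤ ε
    rw [Measure.map_apply he.measurable hmeas.compl]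
    have hsub : e ⁻¹' (WeakDual.toStrongDual ⁻¹' Metric.closedBall 0 (r : ℝ))ᶜ ⊆
        {x | (r : ℝ≥0∞) ^ 2 ≤ (‖x‖₊ : ℝ≥0∞) ^ 2} := by
      intro x hx
      have hx' : (r : ℝ) < ‖x‖ := by simpa [e] using hx
      have : r ≤ ‖x‖₊ := by exact_mod_cast hx'.le
      simp only [Set.mem_ofPred_eq]
      gcongr
    have h1 := mul_meas_ge_le_lintegral (μ := ν i) (f := fun x : H => (‖x‖₊ : ℝ≥0∞) ^ 2)
      (by fun_prop) ((r : ℝ≥0∞) ^ 2)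
    have hr2 : (r : ℝ≥0∞) ^ 2 ≠ 0 := by simp [hr0.ne']
    have hr2' : (r : ℝ≥0∞) ^ 2 ≠ ⊤ := by simp
    have h2 : (r : ℝ≥0∞) ^ 2 * (ν i) {x | (r : ℝ≥0∞) ^ 2 ≤ (‖x‖₊ : ℝ≥0∞) ^ 2} ≤
        (r : ℝ≥0∞) ^ 2 * ε := by
      rw [mul_comm _ ε]; exact h1.trans ((hm i).trans hr)
    exact (measure_mono hsub).trans ((ENNReal.mul_le_mul_iff_right hr2 hr2').1 h2)
  obtain ⟨Q, -, hQ⟩ := hcpt.ultrafilter_le_nhds (U.map P)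
    (by
      rw [Filter.le_principal_iff]
      exact Filter.mem_of_superset (Filter.mem_map.2 (Filter.univ_mem' fun i => Set.mem_range_self i))
        subset_closure)
  have hQ' : Tendsto P U (𝓝 Q) := hQ
  have hlim : ∀ g : BoundedContinuousFunction (WeakDual ℝ H) ℂ,
      Tendsto (fun i => ∫ x, g (e x) ∂(ν i)) U (𝓝 (∫ φ, g φ ∂(Q : Measure (WeakDual ℝ H)))) := by
    intro g
    refine ((ProbabilityMeasure.tendsto_iff_forall_integral_rclike_tendsto ℂ).1 hQ' g).congr ?_
    intro i
    exact integral_map he.aemeasurable g.continuous.aestronglyMeasurable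
  have hlimR : ∀ g : BoundedContinuousFunction (WeakDual ℝ H) ℝ,
      Tendsto (fun i => ∫ x, g (e x) ∂(ν i)) U (𝓝 (∫ φ, g φ ∂(Q : Measure (WeakDual ℝ H)))) := by
    intro g
    refine ((ProbabilityMeasure.tendsto_iff_forall_integral_tendsto).1 hQ' g).congr ?_
    intro i
    exact integral_map he.aemeasurable g.continuous.aestronglyMeasurable
  have hρ : IsProbabilityMeasure ((Q : Measure (WeakDual ℝ H)).map R) :=
    Measure.isProbabilityMeasure_map hR.aemeasurable
  refine ⟨(Q : Measure (WeakDual ℝ H)).map R, hρ, ?_, fun a => ?_⟩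
  · obtain ⟨d, hd⟩ := TopologicalSpace.exists_dense_seq H
    rw [lintegral_map (by fun_prop) hR]
    have hcont : ∀ N, Continuous fun φ : WeakDual ℝ H => sqNormApprox d N φ := by
      intro N
      unfold sqNormApprox
      refine continuous_const.min (continuous_const.max (Continuous.finset_sup'_apply _ ?_))
      intro k _
      exact (continuous_const.mul (WeakDual.eval_continuous (d k))).sub continuous_const
    have hbound : ∀ N, ∫⁻ φ : WeakDual ℝ H, ENNReal.ofReal (sqNormApprox d N φ) ∂Q ≤
        ENNReal.ofReal K := by
      intro N
      let g : BoundedContinuousFunction (WeakDual ℝ H) ℝ :=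
        BoundedContinuousFunction.ofNormedAddCommGroup (fun φ => sqNormApprox d N φ) (hcont N) N
          (fun φ => by
            rw [Real.norm_of_nonneg (sqNormApprox_nonneg _ _ _)]
            exact sqNormApprox_le_natCast _ _ _)
      have h1 : ∫⁻ φ : WeakDual ℝ H, ENNReal.ofReal (sqNormApprox d N φ) ∂Q =
          ENNReal.ofReal (∫ φ, g φ ∂(Q : Measure (WeakDual ℝ H))) :=
        (ofReal_integral_eq_lintegral_ofReal (g.integrable _)
          (ae_of_all _ fun φ => sqNormApprox_nonneg _ _ _)).symm
      rw [h1]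
      refine ENNReal.ofReal_le_ofReal (le_of_tendsto (hlimR g) (Eventually.of_forall fun i => ?_))
      have _ := hν i
      change ∫ x, sqNormApprox d N (e x) ∂(ν i) ≤ K
      rw [integral_eq_lintegral_of_nonneg_ae
        (ae_of_all _ fun x => sqNormApprox_nonneg d N (e x))
        (g.continuous.comp he).aestronglyMeasurable]
      refine ENNReal.toReal_le_of_le_ofReal hK ((lintegral_mono fun x => ?_).trans (hm i))
      rw [← enorm_eq_nnnorm, ← ofReal_norm, ← ENNReal.ofReal_pow (norm_nonneg _)]
      refine ENNReal.ofReal_le_ofReal ?_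
      have := sqNormApprox_inner_le d N x
      simpa only [← e_apply] using this
    have htend : ∀ φ : WeakDual ℝ H, Tendsto (fun N => ENNReal.ofReal (sqNormApprox d N φ)) atTop
        (𝓝 ((‖R φ‖₊ : ℝ≥0∞) ^ 2)) := by
      intro φ
      have h1 := tendsto_sqNormApprox hd (R φ)
      have h2 : (fun a => ⟪R φ, a⟫_ℝ) = φ := by
        ext a; rw [← e_apply, hRe]
      rw [h2] at h1
      rw [← enorm_eq_nnnorm, ← ofReal_norm, ← ENNReal.ofReal_pow (norm_nonneg _)]
      exact (ENNReal.continuous_ofReal.tendsto _).comp h1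
    calc ∫⁻ φ, (‖R φ‖₊ : ℝ≥0∞) ^ 2 ∂Q
        = ∫⁻ φ : WeakDual ℝ H,
            liminf (fun N => ENNReal.ofReal (sqNormApprox d N φ)) atTop ∂Q := by
          congr with φ
          exact (htend φ).liminf_eq.symm
      _ ≤ liminf (fun N => ∫⁻ φ : WeakDual ℝ H, ENNReal.ofReal (sqNormApprox d N φ) ∂Q) atTop :=
          lintegral_liminf_le fun N => (hcont N).measurable.ennreal_ofReal
      _ ≤ ENNReal.ofReal K := by
          refine (liminf_le_liminf (Eventually.of_forall hbound)).trans ?_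
          simp
  · let g : BoundedContinuousFunction (WeakDual ℝ H) ℂ :=
      BoundedContinuousFunction.ofNormedAddCommGroup
        (fun φ => Complex.exp ((φ a : ℂ) * Complex.I))
        (by
          have h : Continuous fun φ : WeakDual ℝ H => φ a := WeakDual.eval_continuous a
          exact Complex.continuous_exp.comp
            ((Complex.continuous_ofReal.comp h).mul continuous_const)) 1
        (fun φ => (Complex.norm_exp_ofReal_mul_I _).le)
    have h1 := hlim g
    have h2 : ∫ φ, g φ ∂(Q : Measure (WeakDual ℝ H)) = charFun (Measure.map R Q) a := by
      rw [charFun_apply, integral_map hR.aemeasurable (by fun_prop)]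
      congr with φ
      have : φ a = ⟪R φ, a⟫_ℝ := by rw [← e_apply, hRe]
      simp [g, this]
    rw [h2] at h1
    refine h1.congr fun i => ?_
    simp [charFun_apply, g, e_apply]

end WeakLimits

section CompoundPoissonLimits

lemma tendsto_one_add_pow_exp {ι : Type*} {l : Filter ι} {k : ι → ℕ} {u : ι → ℂ} {w : ℂ}
    (hk : Tendsto k l atTop) (hu : Tendsto (fun i => (k i : ℂ) * u i) l (𝓝 w)) :
    Tendsto (fun i => (1 + u i) ^ k i) l (𝓝 (Complex.exp w)) := by
  have hinv : Tendsto (fun i => ((k i : ℂ))⁻¹) l (𝓝 0) :=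
    (tendsto_inv_atTop_nhds_zero_nat (𝕜 := ℂ)).comp hk
  have hu0 : Tendsto u l (𝓝 0) := by
    have := hu.mul hinv
    rw [mul_zero] at this
    refine this.congr' ?_
    filter_upwards [hk.eventually_ne_atTop 0] with i hi
    have : (k i : ℂ) ≠ 0 := Nat.cast_ne_zero.2 hi
    field_simp
  have hlog : Tendsto (fun i => (k i : ℂ) * Complex.log (1 + u i)) l (𝓝 w) := by
    have hO : (fun i => (k i : ℂ) * (Complex.log (1 + u i) - u i)) =O[l]
        fun i => ((k i : ℂ) * u i) * u i := by
      have := (Asymptotics.isBigO_refl (fun i => (k i : ℂ)) l).mul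
        (Complex.log_sub_self_isBigO.comp_tendsto hu0)
      refine this.congr (fun _ => rfl) fun i => ?_
      simp only [Function.comp_apply]
      ring
    have h0 : Tendsto (fun i => ((k i : ℂ) * u i) * u i) l (𝓝 0) := by
      simpa using hu.mul hu0
    have := hu.add (hO.trans_tendsto h0)
    rw [add_zero] at this
    exact this.congr fun i => by ring
  refine ((Complex.continuous_exp.tendsto w).comp hlog).congr' ?_
  filter_upwards [hu0.eventually_ne (show (0 : ℂ) ≠ -1 by norm_num)] with i hi
  have hne : 1 + u i ≠ 0 := fun h => hi (by linear_combination h)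
  rw [Function.comp_apply, Complex.exp_nat_mul, Complex.exp_log hne]

variable {H : Type*} [NormedAddCommGroup H] [MeasurableSpace H] [BorelSpace H]
  [SecondCountableTopology H]

lemma isProbabilityMeasure_convPow (ν : Measure H) [IsProbabilityMeasure ν] (n : ℕ) :
    IsProbabilityMeasure (convPow ν n) := by
  induction n with
  | zero => exact Measure.dirac.isProbabilityMeasure
  | succ n ih => exact Measure.probabilitymeasure_of_probabilitymeasures_conv _ _

variable [InnerProductSpace ℝ H]

lemma charFun_convPow (ν : Measure H) [IsProbabilityMeasure ν] (n : ℕ) (a : H) :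
    charFun (convPow ν n) a = charFun ν a ^ n := by
  induction n with
  | zero => simp [convPow, charFun_dirac]
  | succ n ih =>
    have := isProbabilityMeasure_convPow ν n
    rw [pow_succ, ← ih]
    exact charFun_conv _

variable [CompleteSpace H]

lemma lintegral_norm_sq_mconv (μ ν : Measure H) [IsProbabilityMeasure μ] [IsProbabilityMeasure ν]
    (h0 : ∫ x, x ∂ν = 0) (hν : ∫⁻ x, (‖x‖₊ : ℝ≥0∞) ^ 2 ∂ν < ⊤) :
    ∫⁻ x, (‖x‖₊ : ℝ≥0∞) ^ 2 ∂(mconv μ ν) =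
      ∫⁻ x, (‖x‖₊ : ℝ≥0∞) ^ 2 ∂μ + ∫⁻ x, (‖x‖₊ : ℝ≥0∞) ^ 2 ∂ν := by
  change ∫⁻ x, (‖x‖₊ : ℝ≥0∞) ^ 2 ∂(Measure.conv μ ν) = _
  rw [Measure.lintegral_conv (by fun_prop)]
  have hid := integrable_id_of_lintegral_sq_lt_top hν
  have hsq := integrable_norm_sq_of_lintegral_sq_lt_top hν
  have hint (x : H) : ∫⁻ y, (‖x + y‖₊ : ℝ≥0∞) ^ 2 ∂ν =
      (‖x‖₊ : ℝ≥0∞) ^ 2 + ∫⁻ y, (‖y‖₊ : ℝ≥0∞) ^ 2 ∂ν := by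
    have e (z : H) : (‖z‖₊ : ℝ≥0∞) ^ 2 = ENNReal.ofReal (‖z‖ ^ 2) := by
      rw [← enorm_eq_nnnorm, ← ofReal_norm, ← ENNReal.ofReal_pow (norm_nonneg _)]
    have hin : Integrable (fun y : H => 2 * ⟪x, y⟫_ℝ) ν := (hid.const_inner x).const_mul 2
    have hxy : (fun y : H => ‖x + y‖ ^ 2) = fun y => (‖x‖ ^ 2 + 2 * ⟪x, y⟫_ℝ) + ‖y‖ ^ 2 := by
      ext y
      rw [norm_add_sq_real]
    have hi1 : Integrable (fun y : H => ‖x‖ ^ 2 + 2 * ⟪x, y⟫_ℝ) ν := (integrable_const _).add hin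
    have hi : Integrable (fun y : H => ‖x + y‖ ^ 2) ν := by
      rw [hxy]
      exact hi1.add hsq
    simp_rw [e]
    rw [← ofReal_integral_eq_lintegral_ofReal hi (ae_of_all _ fun _ => by positivity),
      ← ofReal_integral_eq_lintegral_ofReal hsq (ae_of_all _ fun _ => by positivity), hxy,
      integral_add hi1 hsq, integral_add (integrable_const _) hin, integral_const_mul,
      integral_inner hid, h0,
      ← ENNReal.ofReal_add (by positivity) (integral_nonneg fun _ => by positivity)]
    simp
  simp_rw [hint]
  rw [lintegral_add_right _ measurable_const]
  simp

lemma lintegral_norm_sq_convPow (ν : Measure H) [IsProbabilityMeasure ν]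
    (h0 : ∫ x, x ∂ν = 0) (hν : ∫⁻ x, (‖x‖₊ : ℝ≥0∞) ^ 2 ∂ν < ⊤) (n : ℕ) :
    ∫⁻ x, (‖x‖₊ : ℝ≥0∞) ^ 2 ∂(convPow ν n) = n * ∫⁻ x, (‖x‖₊ : ℝ≥0∞) ^ 2 ∂ν := by
  induction n with
  | zero => simp [convPow]
  | succ n ih =>
    have := isProbabilityMeasure_convPow ν n
    rw [convPow, lintegral_norm_sq_mconv _ _ h0 hν, ih]
    push_cast
    ring

/-- Roots of the infinitely divisible limit of a null array of centered measures. -/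
lemma exists_charFun_eq_exp_div {ι : Type*} (U : Ultrafilter ι) {n : ι → ℕ}
    (hn : Tendsto n U atTop) (hn1 : ∀ i, 1 ≤ n i) (ν : ι → Measure H)
    (hν : ∀ i, IsProbabilityMeasure (ν i)) (h0 : ∀ i, ∫ x, x ∂(ν i) = 0) {K : ℝ} (hK : 0 ≤ K)
    (hm : ∀ i, ∫⁻ x, (‖x‖₊ : ℝ≥0∞) ^ 2 ∂(ν i) ≤ ENNReal.ofReal (K / n i)) {Ψ : H → ℂ}
    (hΨ : ∀ a, Tendsto (fun i => (n i : ℂ) * (charFun (ν i) a - 1)) U (𝓝 (Ψ a)))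
    {m : ℕ} (hm1 : 1 ≤ m) :
    ∃ ρ : Measure H, IsProbabilityMeasure ρ ∧ ∫ x, x ∂ρ = 0 ∧
      ∫⁻ x, (‖x‖₊ : ℝ≥0∞) ^ 2 ∂ρ ≤ ENNReal.ofReal K ∧
      ∀ a, charFun ρ a = Complex.exp (Ψ a / m) := by
  have hbd (i : ι) : ∫⁻ x, (‖x‖₊ : ℝ≥0∞) ^ 2 ∂(convPow (ν i) (n i / m)) ≤ ENNReal.ofReal K := by
    rw [lintegral_norm_sq_convPow _ (h0 i) ((hm i).trans_lt ENNReal.ofReal_lt_top)]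
    have hni : (0 : ℝ) < n i := by exact_mod_cast hn1 i
    calc ((n i / m : ℕ) : ℝ≥0∞) * _ ≤ (n i : ℝ≥0∞) * ENNReal.ofReal (K / n i) := by
          gcongr
          · exact Nat.div_le_self _ _
          · exact hm i
      _ = ENNReal.ofReal K := by
          rw [← ENNReal.ofReal_natCast, ← ENNReal.ofReal_mul hni.le]
          congr 1
          field_simp
  obtain ⟨ρ, hρ, hρm, hρc⟩ := exists_charFun_limit U (fun i => convPow (ν i) (n i / m))
    (fun i => isProbabilityMeasure_convPow _ _) hK hbd
  have hmpos : (0 : ℝ) < m := by exact_mod_cast hm1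
  have hk : Tendsto (fun i => n i / m) U atTop :=
    (Nat.tendsto_div_const_atTop (by omega)).comp hn
  have hratio : Tendsto (fun i => ((n i / m : ℕ) : ℂ) / (n i : ℂ)) U (𝓝 ((m : ℂ)⁻¹)) := by
    have hreal : Tendsto (fun i => ((n i / m : ℕ) : ℝ) / (n i : ℝ)) U (𝓝 ((m : ℝ)⁻¹)) := by
      have h1 := (tendsto_nat_floor_mul_div_atTop (R := ℝ) (a := (m : ℝ)⁻¹) (by positivity)).comp
        (tendsto_natCast_atTop_atTop.comp hn)
      refine h1.congr fun i => ?_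
      simp only [Function.comp_apply]
      rw [inv_mul_eq_div, Nat.floor_div_eq_div]
    have := (Complex.continuous_ofReal.tendsto _).comp hreal
    simpa [Function.comp_def] using this
  have hlim (a : H) : charFun ρ a = Complex.exp (Ψ a / m) := by
    refine tendsto_nhds_unique (hρc a) ?_
    have h1 : Tendsto (fun i => ((n i / m : ℕ) : ℂ) * (charFun (ν i) a - 1)) U
        (𝓝 (Ψ a / m)) := by
      have := hratio.mul (hΨ a)
      rw [inv_mul_eq_div] at this
      refine this.congr fun i => ?_
      have : (n i : ℂ) ≠ 0 := Nat.cast_ne_zero.2 (by have := hn1 i; omega)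
      field_simp
    refine (tendsto_one_add_pow_exp hk h1).congr fun i => ?_
    rw [charFun_convPow]
    congr 1
    ring
  have hρ0 : ∫ x, x ∂ρ = 0 := by
    have hΨb (a : H) : ‖Ψ a‖ ≤ 3 * K * ‖a‖ ^ 2 := by
      refine le_of_tendsto (hΨ a).norm (Eventually.of_forall fun i => ?_)
      have hni : (0 : ℝ) < n i := by exact_mod_cast hn1 i
      have := norm_charFun_sub_one_le (ν i) (div_nonneg hK hni.le) (h0 i) (hm i) a
      rw [norm_mul, Complex.norm_natCast]
      calc (n i : ℝ) * ‖charFun (ν i) a - 1‖ ≤ n i * (3 * (K / n i) * ‖a‖ ^ 2) := by gcongr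
        _ = 3 * K * ‖a‖ ^ 2 := by field_simp
    refine integral_id_eq_zero_of_norm_charFun_sub_one_le ρ (C := 2 * (3 * K) + 2 * (3 * K)) hK hρm
      fun a => ?_
    rw [hlim]
    have hle : ‖Ψ a / m‖ ≤ 3 * K * ‖a‖ ^ 2 := by
      rw [norm_div, Complex.norm_natCast]
      refine (div_le_self (norm_nonneg _) ?_).trans (hΨb a)
      exact_mod_cast hm1
    have hKa : 0 ≤ 3 * K * ‖a‖ ^ 2 := by positivity
    rcases le_total ‖Ψ a / m‖ 1 with h | h
    · have := Complex.norm_exp_sub_one_le h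
      nlinarith
    · have h1 : ‖Complex.exp (Ψ a / m) - 1‖ ≤ 1 + 1 := by
        refine (norm_sub_le _ _).trans (add_le_add ?_ norm_one.le)
        rw [← hlim]
        exact norm_charFun_le_one a
      nlinarith
  exact ⟨ρ, hρ, hρ0, hρm, hlim⟩

end CompoundPoissonLimits

section Semigroups

open ContinuousLinearMap

variable {H : Type*} [NormedAddCommGroup H] [InnerProductSpace ℝ H]

/-- Semigroups extended by `T 0` to negative times have continuous orbits. -/
lemma IsC0.continuous_max {T : ℝ → H →L[ℝ] H} (hT : IsC0 T) (x : H) :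
    Continuous fun s => T (max s 0) x :=
  (hT.2.2 x).comp_continuous (by fun_prop) fun s => le_max_right s 0

lemma IsC0.zero_apply {T : ℝ → H →L[ℝ] H} (hT : IsC0 T) (x : H) : T 0 x = x := by
  rw [hT.1]
  rfl

lemma IsC0.add_apply {T : ℝ → H →L[ℝ] H} (hT : IsC0 T) {s t : ℝ} (hs : 0 ≤ s) (ht : 0 ≤ t)
    (x : H) : T (s + t) x = T s (T t x) := by
  rw [hT.2.1 s t hs ht]
  rfl

/-- Exponentially bounded semigroups are bounded on bounded intervals. -/
lemma exists_norm_le_of_le_exp {T : ℝ → H →L[ℝ] H} {c₀ b₀ : ℝ} (hc₀ : 0 ≤ c₀) (hb₀ : 0 ≤ b₀)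
    (hbd : ∀ t : ℝ, 0 ≤ t → ‖T t‖ ≤ c₀ * Real.exp (b₀ * t)) (R : ℝ) :
    ∃ M : ℝ, 0 ≤ M ∧ ∀ t, 0 ≤ t → t ≤ R → ‖T t‖ ≤ M :=
  ⟨c₀ * Real.exp (b₀ * R), by positivity, fun t h0 hR => (hbd t h0).trans (by gcongr)⟩

variable [CompleteSpace H]

lemma IsC0.adjoint_add_apply {T : ℝ → H →L[ℝ] H} (hT : IsC0 T) {s t : ℝ} (hs : 0 ≤ s)
    (ht : 0 ≤ t) (a : H) : adjoint (T (s + t)) a = adjoint (T t) (adjoint (T s) a) := by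
  rw [hT.2.1 s t hs ht, adjoint_comp]
  rfl

lemma IsC0.adjoint_zero_apply {T : ℝ → H →L[ℝ] H} (hT : IsC0 T) (a : H) :
    adjoint (T 0) a = a := by
  refine ext_inner_left ℝ fun v => ?_
  rw [adjoint_inner_right, hT.zero_apply]

/-- The vectors at which the adjoint semigroup is continuous at time zero. -/
def adjointContinuityDomain (T : ℝ → H →L[ℝ] H) : Submodule ℝ H where
  carrier := {a | Tendsto (fun s => adjoint (T s) a) (𝓝[>] 0) (𝓝 a)}
  add_mem' {a b} ha hb := by
    simp only [Set.mem_ofPred_eq, map_add] at *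
    exact ha.add hb
  zero_mem' := by simp
  smul_mem' c a ha := by
    simp only [Set.mem_ofPred_eq, map_smul] at *
    exact ha.const_smul c

lemma mem_adjointContinuityDomain {T : ℝ → H →L[ℝ] H} {a : H} :
    a ∈ adjointContinuityDomain T ↔ Tendsto (fun s => adjoint (T s) a) (𝓝[>] 0) (𝓝 a) :=
  Iff.rfl

lemma isClosed_adjointContinuityDomain {T : ℝ → H →L[ℝ] H} {M : ℝ}
    (hM : 0 ≤ M) (hTM : ∀ t, 0 ≤ t → t ≤ 1 → ‖T t‖ ≤ M) :
    IsClosed (adjointContinuityDomain T : Set H) := by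
  refine isClosed_of_closure_subset fun a ha => ?_
  rw [SetLike.mem_coe, mem_adjointContinuityDomain, Metric.tendsto_nhds]
  intro ε hε
  obtain ⟨b, hb, hab⟩ := Metric.mem_closure_iff.1 ha (ε / (2 * (M + 1))) (by positivity)
  have hb' := Metric.tendsto_nhds.1 (mem_adjointContinuityDomain.1 hb) (ε / 2) (by positivity)
  have h1 : ∀ᶠ s : ℝ in 𝓝[>] 0, s ≤ 1 :=
    (eventually_le_nhds (show (0 : ℝ) < 1 by norm_num)).filter_mono nhdsWithin_le_nhds
  filter_upwards [hb', h1, self_mem_nhdsWithin] with s hs hs1 hs0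
  rw [dist_eq_norm] at *
  have hle : ‖adjoint (T s) (a - b)‖ ≤ M * ‖a - b‖ := by
    refine (le_opNorm _ _).trans ?_
    rw [LinearIsometryEquiv.norm_map]
    gcongr
    exact hTM s (le_of_lt hs0) hs1
  have h2 : adjoint (T s) a - a =
      adjoint (T s) (a - b) + (adjoint (T s) b - b) - (a - b) := by
    rw [map_sub]; abel
  rw [h2]
  calc _ ≤ M * ‖a - b‖ + ‖adjoint (T s) b - b‖ + ‖a - b‖ :=
        (norm_sub_le _ _).trans (by gcongr; exact (norm_add_le _ _).trans (by gcongr))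
    _ = (M + 1) * ‖a - b‖ + ‖adjoint (T s) b - b‖ := by ring
    _ < (M + 1) * (ε / (2 * (M + 1))) + ε / 2 := by gcongr
    _ = ε := by field_simp; ring

/-- Time averages of the adjoint semigroup map into the continuity domain. -/
lemma exists_mem_adjointContinuityDomain {T : ℝ → H →L[ℝ] H} (hT : IsC0 T) {M : ℝ}
    (hTM : ∀ t, 0 ≤ t → t ≤ 2 → ‖T t‖ ≤ M) (a : H) {r : ℝ} (hr0 : 0 ≤ r) (hr1 : r ≤ 1) :
    ∃ b ∈ adjointContinuityDomain T,
      ∀ x, ⟪b, x⟫_ℝ = ∫ u in (0 : ℝ)..r, ⟪a, T (max u 0) x⟫_ℝ := by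
  have hM : 0 ≤ M := (norm_nonneg _).trans (hTM 0 le_rfl (by norm_num))
  have hcont (x : H) : Continuous fun u => ⟪a, T (max u 0) x⟫_ℝ :=
    continuous_const.inner (hT.continuous_max x)
  have hii (x : H) (p q : ℝ) :
      IntervalIntegrable (fun u => ⟪a, T (max u 0) x⟫_ℝ) volume p q :=
    (hcont x).intervalIntegrable p q
  have hbound (x : H) (p q : ℝ) (hp : 0 ≤ p) (hpq : p ≤ q) (hq : q ≤ 2) :
      ‖∫ u in p..q, ⟪a, T (max u 0) x⟫_ℝ‖ ≤ (M * ‖a‖ * (q - p)) * ‖x‖ := by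
    have := intervalIntegral.norm_integral_le_of_norm_le_const (a := p) (b := q)
      (f := fun u => ⟪a, T (max u 0) x⟫_ℝ) (C := M * ‖a‖ * ‖x‖) fun u hu => by
        rw [Set.uIoc_of_le hpq] at hu
        rw [max_eq_left (hp.trans hu.1.le)]
        calc ‖⟪a, T u x⟫_ℝ‖ ≤ ‖a‖ * ‖T u x‖ := norm_inner_le_norm _ _
          _ ≤ ‖a‖ * (M * ‖x‖) := by
            gcongr
            exact (T u).le_of_opNorm_le (hTM u (hp.trans hu.1.le) (hu.2.trans hq)) x
          _ = M * ‖a‖ * ‖x‖ := by ring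
    rw [abs_of_nonneg (sub_nonneg.2 hpq)] at this
    linarith
  let φ : H →ₗ[ℝ] ℝ :=
    { toFun := fun x => ∫ u in (0 : ℝ)..r, ⟪a, T (max u 0) x⟫_ℝ
      map_add' := fun x y => by
        rw [← intervalIntegral.integral_add (hii x 0 r) (hii y 0 r)]
        simp [inner_add_right]
      map_smul' := fun c x => by
        simp [inner_smul_right] }
  let Φ : StrongDual ℝ H := φ.mkContinuous (M * ‖a‖ * (r - 0)) fun x =>
    hbound x 0 r le_rfl hr0 (by linarith)
  refine ⟨(InnerProductSpace.toDual ℝ H).symm Φ, ?_, fun x => ?_⟩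
  swap
  · rw [InnerProductSpace.toDual_symm_apply]
    rfl
  set b := (InnerProductSpace.toDual ℝ H).symm Φ with hb
  have hbx (x : H) : ⟪b, x⟫_ℝ = ∫ u in (0 : ℝ)..r, ⟪a, T (max u 0) x⟫_ℝ := by
    rw [hb, InnerProductSpace.toDual_symm_apply]
    rfl
  rw [mem_adjointContinuityDomain, tendsto_iff_norm_sub_tendsto_zero]
  have hlim : Tendsto (fun s : ℝ => 2 * (M * ‖a‖ * s)) (𝓝[>] 0) (𝓝 0) := by
    have : Tendsto (fun s : ℝ => 2 * (M * ‖a‖ * s)) (𝓝 0) (𝓝 (2 * (M * ‖a‖ * 0))) :=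
      Continuous.tendsto (by fun_prop) 0
    simpa using this.mono_left nhdsWithin_le_nhds
  refine squeeze_zero' (Eventually.of_forall fun s => norm_nonneg _) ?_ hlim
  have h1 : ∀ᶠ s : ℝ in 𝓝[>] 0, s ≤ 1 :=
    (eventually_le_nhds (show (0 : ℝ) < 1 by norm_num)).filter_mono nhdsWithin_le_nhds
  filter_upwards [h1, self_mem_nhdsWithin] with s hs1 hs0
  have hs0 : 0 < s := hs0
  have key (x : H) : ⟪adjoint (T s) b - b, x⟫_ℝ ≤ 2 * (M * ‖a‖ * s) * ‖x‖ := by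
    have hshift : ⟪b, T s x⟫_ℝ = ∫ u in s..(r + s), ⟪a, T (max u 0) x⟫_ℝ := by
      rw [hbx]
      have := intervalIntegral.integral_comp_add_right (a := 0) (b := r)
        (fun u => ⟪a, T (max u 0) x⟫_ℝ) s
      rw [zero_add] at this
      rw [← this]
      refine intervalIntegral.integral_congr fun u hu => ?_
      rw [Set.uIcc_of_le hr0] at hu
      rw [max_eq_left hu.1, max_eq_left (by linarith [hu.1]), hT.add_apply hu.1 hs0.le]
    have hsplit : (∫ u in s..(r + s), ⟪a, T (max u 0) x⟫_ℝ) -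
        ∫ u in (0 : ℝ)..r, ⟪a, T (max u 0) x⟫_ℝ =
        (∫ u in r..(r + s), ⟪a, T (max u 0) x⟫_ℝ) -
        ∫ u in (0 : ℝ)..s, ⟪a, T (max u 0) x⟫_ℝ := by
      have e1 := intervalIntegral.integral_add_adjacent_intervals (hii x 0 s) (hii x s (r + s))
      have e2 := intervalIntegral.integral_add_adjacent_intervals (hii x 0 r) (hii x r (r + s))
      linarith
    rw [inner_sub_left, adjoint_inner_left, hshift, hbx, hsplit]
    have h2 := hbound x r (r + s) hr0 (by linarith) (by linarith)
    have h3 := hbound x 0 s le_rfl hs0.le (by linarith)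
    rw [Real.norm_eq_abs] at h2 h3
    have h4 := (abs_le.1 h2).2
    have h5 := (abs_le.1 h3).1
    have e : r + s - r = s := by ring
    rw [e] at h4
    rw [sub_zero] at h5
    linarith
  have hk := key (adjoint (T s) b - b)
  rw [real_inner_self_eq_norm_sq, sq] at hk
  rcases (norm_nonneg (adjoint (T s) b - b)).eq_or_lt with h | h
  · rw [← h]; positivity
  · exact le_of_mul_le_mul_right hk h

lemma adjointContinuityDomain_eq_top {T : ℝ → H →L[ℝ] H} (hT : IsC0 T) {M : ℝ}
    (hTM : ∀ t, 0 ≤ t → t ≤ 2 → ‖T t‖ ≤ M) : adjointContinuityDomain T = ⊤ := by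
  have hM : 0 ≤ M := (norm_nonneg _).trans (hTM 0 le_rfl (by norm_num))
  have hcl := isClosed_adjointContinuityDomain hM
    fun t h0 h1 => hTM t h0 (h1.trans (by norm_num))
  have : CompleteSpace (adjointContinuityDomain T) := hcl.completeSpace_coe
  rw [← Submodule.orthogonal_eq_bot_iff, Submodule.eq_bot_iff]
  intro a ha
  have hcont : Continuous fun u => ⟪a, T (max u 0) a⟫_ℝ :=
    continuous_const.inner (hT.continuous_max a)
  have hzero (r : ℝ) (hr : r ∈ Set.Icc (0 : ℝ) 1) :
      ∫ u in (0 : ℝ)..r, ⟪a, T (max u 0) a⟫_ℝ = 0 := by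
    obtain ⟨b, hb, hbx⟩ := exists_mem_adjointContinuityDomain hT hTM a hr.1 hr.2
    rw [← hbx]
    exact (Submodule.mem_orthogonal _ _).1 ha b hb
  have hd : HasDerivWithinAt (fun r => ∫ u in (0 : ℝ)..r, ⟪a, T (max u 0) a⟫_ℝ)
      ⟪a, T (max 0 0) a⟫_ℝ (Set.Icc 0 1) 0 :=
    (intervalIntegral.integral_hasDerivAt_right (hcont.intervalIntegrable _ _)
      (hcont.stronglyMeasurableAtFilter _ _) hcont.continuousAt).hasDerivWithinAt
  have hd0 : HasDerivWithinAt (fun r => ∫ u in (0 : ℝ)..r, ⟪a, T (max u 0) a⟫_ℝ)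
      0 (Set.Icc 0 1) 0 :=
    (hasDerivWithinAt_const (0 : ℝ) (Set.Icc (0 : ℝ) 1) (0 : ℝ)).congr
      (fun r hr => hzero r hr) (hzero 0 (by simp))
  have huniq := (uniqueDiffOn_Icc (show (0 : ℝ) < 1 by norm_num) 0 (by simp)).eq_deriv _ hd hd0
  rwa [max_self, hT.zero_apply, inner_self_eq_zero] at huniq

/-- The adjoint of a strongly continuous semigroup on a Hilbert space is strongly continuous. -/
lemma IsC0.continuousOn_adjoint {T : ℝ → H →L[ℝ] H} (hT : IsC0 T) {c₀ b₀ : ℝ} (hc₀ : 0 ≤ c₀)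
    (hb₀ : 0 ≤ b₀) (hbd : ∀ t : ℝ, 0 ≤ t → ‖T t‖ ≤ c₀ * Real.exp (b₀ * t)) (a : H) :
    ContinuousOn (fun s => adjoint (T s) a) (Set.Ici 0) := by
  obtain ⟨M₂, -, hM₂⟩ := exists_norm_le_of_le_exp hc₀ hb₀ hbd 2
  have h0 : Tendsto (fun s => adjoint (T s) a) (𝓝[>] 0) (𝓝 a) := by
    rw [← mem_adjointContinuityDomain, adjointContinuityDomain_eq_top hT hM₂]
    trivial
  intro s hs
  have hs : 0 ≤ s := hs
  obtain ⟨M, hM, hTM⟩ := exists_norm_le_of_le_exp hc₀ hb₀ hbd (s + 1)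
  have hdiff (p q : ℝ) (hp : 0 ≤ p) (hpq : p ≤ q) (hq : p ≤ s + 1) :
      ‖adjoint (T q) a - adjoint (T p) a‖ ≤ M * ‖adjoint (T (q - p)) a - a‖ := by
    have e : adjoint (T q) a = adjoint (T p) (adjoint (T (q - p)) a) := by
      rw [← hT.adjoint_add_apply (by linarith) hp]
      congr 3
      ring
    rw [e, ← map_sub]
    refine (adjoint (T p)).le_of_opNorm_le ?_ _
    rw [LinearIsometryEquiv.norm_map]
    exact hTM p hp hq
  have h0' : Tendsto (fun s => ‖adjoint (T s) a - a‖) (𝓝[≥] 0) (𝓝 0) := by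
    rw [← tendsto_iff_norm_sub_tendsto_zero, ← Set.Ioi_insert, nhdsWithin_insert,
      tendsto_sup]
    refine ⟨?_, h0⟩
    rw [tendsto_pure_left]
    intro s hs
    rw [hT.adjoint_zero_apply]
    exact mem_of_mem_nhds hs
  have habs : Tendsto (fun p : ℝ => |p - s|) (𝓝[Set.Ici 0] s) (𝓝[≥] 0) := by
    refine tendsto_nhdsWithin_iff.2 ⟨?_, Eventually.of_forall fun p => Set.mem_Ici.2 (abs_nonneg _)⟩
    have : Tendsto (fun p : ℝ => |p - s|) (𝓝 s) (𝓝 |s - s|) :=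
      Continuous.tendsto (by fun_prop) s
    simpa using this.mono_left nhdsWithin_le_nhds
  rw [ContinuousWithinAt, tendsto_iff_norm_sub_tendsto_zero]
  have hlim : Tendsto (fun p : ℝ => M * ‖adjoint (T |p - s|) a - a‖) (𝓝[Set.Ici 0] s) (𝓝 0) := by
    simpa using (h0'.comp habs).const_mul M
  refine squeeze_zero' (Eventually.of_forall fun p => norm_nonneg _) ?_ hlim
  filter_upwards [self_mem_nhdsWithin] with p hp
  rcases le_total s p with h | h
  · rw [abs_of_nonneg (sub_nonneg.2 h)]
    exact hdiff s p hs h (by linarith)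
  · rw [abs_sub_comm, abs_of_nonneg (sub_nonneg.2 h), norm_sub_rev]
    exact hdiff p s hp h (by linarith)

end Semigroups

section Observability

variable {H : Type*} [NormedAddCommGroup H] [InnerProductSpace ℝ H]

lemma IsC0.memLp_orbit {T : ℝ → H →L[ℝ] H} (hT : IsC0 T) {M : ℝ}
    (hTM : ∀ t, 0 ≤ t → t ≤ 1 → ‖T t‖ ≤ M) (x : H) :
    MemLp (fun s => T (max s 0) x) 2 (volume.restrict (Set.Ioo (0 : ℝ) 1)) := by
  refine MemLp.of_bound ?_ (M * ‖x‖) ?_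
  · exact (hT.continuous_max x).aestronglyMeasurable
  · refine (ae_restrict_iff' measurableSet_Ioo).2 (ae_of_all _ fun s hs => ?_)
    rw [max_eq_left hs.1.le]
    exact (T s).le_of_opNorm_le (hTM s hs.1.le hs.2.le) x

/-- The map sending `x` to its orbit, as a square integrable function on the unit interval. -/
def orbitMap (T : ℝ → H →L[ℝ] H) (hT : IsC0 T) {M : ℝ}
    (hTM : ∀ t, 0 ≤ t → t ≤ 1 → ‖T t‖ ≤ M) :
    H →L[ℝ] Lp H 2 (volume.restrict (Set.Ioo (0 : ℝ) 1)) :=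
  LinearMap.mkContinuous
    { toFun := fun x => (hT.memLp_orbit hTM x).toLp
      map_add' := fun x y => by
        rw [← MemLp.toLp_add]
        congr 1
        ext s
        simp
      map_smul' := fun c x => by
        rw [RingHom.id_apply, ← MemLp.toLp_const_smul]
        congr 1
        ext s
        simp } M fun x => by
    have h := Lp.norm_le_of_ae_bound (f := (hT.memLp_orbit hTM x).toLp) (C := M * ‖x‖)
      (mul_nonneg ((norm_nonneg _).trans (hTM 0 le_rfl zero_le_one)) (norm_nonneg x)) (by
        filter_upwards [(hT.memLp_orbit hTM x).coeFn_toLp,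
          ae_restrict_mem measurableSet_Ioo] with s h1 hs
        rw [h1, max_eq_left hs.1.le]
        exact (T s).le_of_opNorm_le (hTM s hs.1.le hs.2.le) x)
    refine h.trans_eq ?_
    simp [measureUnivNNReal]

lemma coeFn_orbitMap {T : ℝ → H →L[ℝ] H} (hT : IsC0 T) {M : ℝ}
    (hTM : ∀ t, 0 ≤ t → t ≤ 1 → ‖T t‖ ≤ M) (x : H) :
    orbitMap T hT hTM x =ᵐ[volume.restrict (Set.Ioo (0 : ℝ) 1)] fun s => T s x := by
  filter_upwards [(hT.memLp_orbit hTM x).coeFn_toLp, ae_restrict_mem measurableSet_Ioo] with s h hs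
  rw [max_eq_left hs.1.le] at h
  exact h

/-- A property holding almost everywhere on the unit interval holds at arbitrarily small times. -/
lemma exists_lt_of_ae_restrict_Ioo {p : ℝ → Prop}
    (hp : ∀ᵐ s ∂(volume.restrict (Set.Ioo (0 : ℝ) 1)), p s) {ε : ℝ} (hε : 0 < ε) :
    ∃ s, 0 < s ∧ s < ε ∧ p s := by
  have h1 : volume.restrict (Set.Ioo (0 : ℝ) (min ε 1)) ≠ 0 := by
    rw [Ne, Measure.restrict_eq_zero, Real.volume_Ioo, sub_zero, ENNReal.ofReal_eq_zero, not_le]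
    positivity
  have h2 : ∀ᵐ s ∂(volume.restrict (Set.Ioo (0 : ℝ) (min ε 1))), p s :=
    ae_mono (Measure.restrict_mono (Set.Ioo_subset_Ioo_right (min_le_right _ _)) le_rfl) hp
  have : (ae (volume.restrict (Set.Ioo (0 : ℝ) (min ε 1)))).NeBot := ae_neBot.2 h1
  obtain ⟨s, hs, hps⟩ := ((ae_restrict_mem measurableSet_Ioo).and h2).exists
  exact ⟨s, hs.1, hs.2.trans_le (min_le_left _ _), hps⟩

lemma IsC0.tendsto_zero {T : ℝ → H →L[ℝ] H} (hT : IsC0 T) (x : H) :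
    Tendsto (fun s => T s x) (𝓝[>] 0) (𝓝 x) := by
  have := (hT.2.2 x 0 Set.self_mem_Ici).mono Set.Ioi_subset_Ici_self
  rwa [ContinuousWithinAt, hT.zero_apply] at this

lemma orbitMap_injective {T : ℝ → H →L[ℝ] H} (hT : IsC0 T) {M : ℝ}
    (hTM : ∀ t, 0 ≤ t → t ≤ 1 → ‖T t‖ ≤ M) : Function.Injective (orbitMap T hT hTM) := by
  rw [injective_iff_map_eq_zero]
  intro x hx
  have h0 : ∀ᵐ s ∂(volume.restrict (Set.Ioo (0 : ℝ) 1)), T s x = 0 := by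
    filter_upwards [coeFn_orbitMap hT hTM x, Lp.coeFn_zero H 2 (volume.restrict (Set.Ioo (0 : ℝ) 1))]
      with s h1 h2
    rw [← h1, hx, h2]
    rfl
  have hall (s : ℝ) (hs : 0 < s) : T s x = 0 := by
    obtain ⟨r, hr0, hrs, hr⟩ := exists_lt_of_ae_restrict_Ioo h0 hs
    rw [show s = (s - r) + r by ring, hT.add_apply (by linarith) hr0.le, hr, map_zero]
  refine tendsto_nhds_unique (hT.tendsto_zero x) ?_
  exact tendsto_const_nhds.congr' (eventually_nhdsWithin_of_forall fun s hs => (hall s hs).symm)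

lemma isClosed_range_orbitMap {T : ℝ → H →L[ℝ] H} (hT : IsC0 T) {M : ℝ}
    (hTM : ∀ t, 0 ≤ t → t ≤ 1 → ‖T t‖ ≤ M)
    (hcl : ∀ x : ℝ → H, MemHt T x → ∃ x₀ : H, ∀ s : ℝ, 0 < s → x s = T s x₀) :
    IsClosed (Set.range (orbitMap T hT hTM)) := by
  refine isClosed_of_closure_subset fun y hy => ?_
  obtain ⟨z, hz, hzy⟩ := mem_closure_iff_seq_limit.1 hy
  choose v hv using hz
  have hmeas : TendstoInMeasure (volume.restrict (Set.Ioo (0 : ℝ) 1)) (fun n => (z n : ℝ → H))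
      atTop y := tendstoInMeasure_of_tendsto_Lp hzy
  obtain ⟨φ, hφ, hae⟩ := hmeas.exists_seq_tendsto_ae
  have hae' : ∀ᵐ s ∂(volume.restrict (Set.Ioo (0 : ℝ) 1)),
      Tendsto (fun n => T s (v (φ n))) atTop (𝓝 (y s)) := by
    have h2 : ∀ᵐ s ∂(volume.restrict (Set.Ioo (0 : ℝ) 1)), ∀ n, (z n : ℝ → H) s = T s (v n) := by
      rw [ae_all_iff]
      intro n
      rw [← hv n]
      exact coeFn_orbitMap hT hTM (v n)
    filter_upwards [hae, h2] with s h1 h2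
    exact h1.congr fun n => h2 _
  have hconv (s : ℝ) (hs : 0 < s) : ∃ w, Tendsto (fun n => T s (v (φ n))) atTop (𝓝 w) := by
    obtain ⟨r, hr0, hrs, hr⟩ := exists_lt_of_ae_restrict_Ioo hae' hs
    refine ⟨T (s - r) (y r), (((T (s - r)).continuous.tendsto _).comp hr).congr fun n => ?_⟩
    rw [Function.comp_apply, ← hT.add_apply (by linarith) hr0.le, sub_add_cancel]
  choose! w hw using hconv
  let x : ℝ → H := fun s => if 0 < s then w s else 0
  have hxw (s : ℝ) (hs : 0 < s) : x s = w s := if_pos hs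
  have hxy : ∀ᵐ s ∂(volume.restrict (Set.Ioo (0 : ℝ) 1)), x s = y s := by
    filter_upwards [hae', ae_restrict_mem measurableSet_Ioo] with s h1 hs
    rw [hxw s hs.1]
    exact tendsto_nhds_unique (hw s hs.1) h1
  have hx : MemHt T x := by
    refine ⟨⟨fun s hs => if_neg hs.not_gt, fun r t hr ht => ?_⟩, 1, one_pos, ?_⟩
    · rw [hxw _ (by linarith), hxw _ hr]
      refine tendsto_nhds_unique (hw (r + t) (by linarith)) ?_
      refine (((T t).continuous.tendsto _).comp (hw r hr)).congr fun n => ?_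
      rw [Function.comp_apply, ← hT.add_apply ht.le hr.le, add_comm]
    · have := (Lp.memLp y).eLpNorm_lt_top
      rw [eLpNorm_lt_top_iff_lintegral_rpow_enorm_lt_top (by norm_num) (by norm_num)] at this
      refine lt_of_eq_of_lt (lintegral_congr_ae ?_) this
      filter_upwards [hxy] with s hs
      simp [hs, enorm_eq_nnnorm]
  obtain ⟨x₀, hx₀⟩ := hcl x hx
  refine ⟨x₀, Lp.ext ?_⟩
  filter_upwards [coeFn_orbitMap hT hTM x₀, hxy, ae_restrict_mem measurableSet_Ioo] with s h1 h2 hs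
  rw [h1, ← h2, hx₀ s hs.1]

variable [CompleteSpace H]

/-- If all locally square integrable entrance paths are closable, then the semigroup satisfies
an observability estimate. -/
lemma exists_norm_sq_le_lintegral_orbit {T : ℝ → H →L[ℝ] H} (hT : IsC0 T) {M : ℝ}
    (hTM : ∀ t, 0 ≤ t → t ≤ 1 → ‖T t‖ ≤ M)
    (hcl : ∀ x : ℝ → H, MemHt T x → ∃ x₀ : H, ∀ s : ℝ, 0 < s → x s = T s x₀) :
    ∃ C : ℝ≥0, ∀ x : H, (‖x‖₊ : ℝ≥0∞) ^ 2 ≤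
      C * ∫⁻ s in Set.Ioo (0 : ℝ) 1, (‖T s x‖₊ : ℝ≥0∞) ^ 2 := by
  obtain ⟨C, hC⟩ := (orbitMap T hT hTM).antilipschitz_of_injective_of_isClosed_range
    (orbitMap_injective hT hTM) (isClosed_range_orbitMap hT hTM hcl)
  refine ⟨C ^ 2, fun x => ?_⟩
  have h1 : ‖x‖ₑ ≤ C * ‖orbitMap T hT hTM x‖ₑ := by
    have := hC x 0
    simpa [edist_zero_right] using this
  have h2 : ‖orbitMap T hT hTM x‖ₑ ^ 2 = ∫⁻ s in Set.Ioo (0 : ℝ) 1, (‖T s x‖₊ : ℝ≥0∞) ^ 2 := by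
    rw [Lp.enorm_def, eLpNorm_eq_lintegral_rpow_enorm_toReal (by norm_num) (by norm_num)]
    rw [← ENNReal.rpow_natCast, ← ENNReal.rpow_mul]
    simp only [ENNReal.toReal_ofNat, Nat.cast_ofNat, one_div, inv_mul_cancel₀ (two_ne_zero' ℝ),
      ENNReal.rpow_one]
    refine lintegral_congr_ae ?_
    filter_upwards [coeFn_orbitMap hT hTM x] with s hs
    rw [hs, enorm_eq_nnnorm]
    norm_cast
  rw [← h2, ENNReal.coe_pow, ← mul_pow, ← enorm_eq_nnnorm]
  gcongr

end Observability

section SecondMoments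

variable {H : Type*} [NormedAddCommGroup H] [InnerProductSpace ℝ H] [CompleteSpace H]
  [MeasurableSpace H] [BorelSpace H] [SecondCountableTopology H]

/-- The second moments of a centered SC-semigroup. -/
lemma IsSC.lintegral_norm_sq_add {T : ℝ → H →L[ℝ] H} {μ : ℝ → Measure H} (hμ : IsSC T μ)
    (h0 : ∀ t : ℝ, 0 ≤ t → ∫ x, x ∂(μ t) = 0)
    (h2 : ∀ t : ℝ, 0 ≤ t → ∫⁻ x, (‖x‖₊ : ℝ≥0∞) ^ 2 ∂(μ t) < ⊤) {r t : ℝ} (hr : 0 ≤ r)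
    (ht : 0 ≤ t) :
    ∫⁻ x, (‖x‖₊ : ℝ≥0∞) ^ 2 ∂(μ (r + t)) =
      ∫⁻ x, (‖T t x‖₊ : ℝ≥0∞) ^ 2 ∂(μ r) + ∫⁻ x, (‖x‖₊ : ℝ≥0∞) ^ 2 ∂(μ t) := by
  have _ := hμ.1 t ht
  have _ := hμ.1 r hr
  have _ : IsProbabilityMeasure ((μ r).map (T t)) :=
    Measure.isProbabilityMeasure_map (T t).continuous.aemeasurable
  rw [hμ.2 r t hr ht, lintegral_norm_sq_mconv _ _ (h0 t ht) (h2 t ht),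
    lintegral_map (by fun_prop) (T t).continuous.measurable]

/-- Under an observability estimate, the second moments of a centered SC-semigroup grow at most
linearly near time zero. -/
lemma IsSC.lintegral_norm_sq_le {T : ℝ → H →L[ℝ] H} (hT : IsC0 T) {μ : ℝ → Measure H}
    (hμ : IsSC T μ) (h0 : ∀ t : ℝ, 0 ≤ t → ∫ x, x ∂(μ t) = 0)
    (h2 : ∀ t : ℝ, 0 ≤ t → ∫⁻ x, (‖x‖₊ : ℝ≥0∞) ^ 2 ∂(μ t) < ⊤) {C : ℝ≥0}
    (hC : ∀ x : H, (‖x‖₊ : ℝ≥0∞) ^ 2 ≤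
      C * ∫⁻ s in Set.Ioo (0 : ℝ) 1, (‖T s x‖₊ : ℝ≥0∞) ^ 2) :
    ∃ K : ℝ, 0 ≤ K ∧ ∀ h : ℝ, 0 ≤ h → h ≤ 1 →
      ∫⁻ x, (‖x‖₊ : ℝ≥0∞) ^ 2 ∂(μ h) ≤ ENNReal.ofReal (K * h) := by
  set V : ℝ → ℝ≥0∞ := fun t => ∫⁻ x, (‖x‖₊ : ℝ≥0∞) ^ 2 ∂(μ (max t 0)) with hV
  have hVadd (r t : ℝ) (hr : 0 ≤ r) (ht : 0 ≤ t) :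
      V (r + t) = ∫⁻ x, (‖T t x‖₊ : ℝ≥0∞) ^ 2 ∂(μ r) + V t := by
    simp only [hV]
    rw [max_eq_left ht, max_eq_left (add_nonneg hr ht), hμ.lintegral_norm_sq_add h0 h2 hr ht]
  have hVmono : Monotone V := by
    intro s t hst
    have e : V t = V ((max t 0 - max s 0) + max s 0) := by simp [hV]
    have e' : V s = V (max s 0) := by simp [hV]
    rw [e, e', hVadd _ _ (sub_nonneg.2 (max_le_max_right 0 hst)) (le_max_right _ _)]
    exact le_add_self
  have hVmeas : Measurable V := hVmono.measurable
  have hVfin (t : ℝ) : V t < ⊤ := h2 _ (le_max_right _ _)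
  refine ⟨C * (V 2).toReal, by positivity, fun h hh0 hh1 => ?_⟩
  have _ := hμ.1 h hh0
  have hjoint : Measurable (Function.uncurry fun (x : H) (s : ℝ) =>
      (‖T (max s 0) x‖₊ : ℝ≥0∞) ^ 2) := by
    have : Measurable (Function.uncurry fun (s : ℝ) (x : H) => T (max s 0) x) :=
      measurable_uncurry_of_continuous_of_measurable (fun x => hT.continuous_max x)
        fun s => (T _).continuous.measurable
    exact ((this.comp measurable_swap).nnnorm.coe_nnreal_ennreal).pow_const 2
  have hswap : ∫⁻ x, (∫⁻ s in Set.Ioo (0 : ℝ) 1, (‖T s x‖₊ : ℝ≥0∞) ^ 2) ∂(μ h) =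
      ∫⁻ s in Set.Ioo (0 : ℝ) 1, ∫⁻ x, (‖T s x‖₊ : ℝ≥0∞) ^ 2 ∂(μ h) := by
    have := lintegral_lintegral_swap (μ := μ h) (ν := volume.restrict (Set.Ioo (0 : ℝ) 1))
      hjoint.aemeasurable
    calc _ = ∫⁻ x, (∫⁻ s in Set.Ioo (0 : ℝ) 1, (‖T (max s 0) x‖₊ : ℝ≥0∞) ^ 2) ∂(μ h) := by
          congr with x
          refine setLIntegral_congr_fun measurableSet_Ioo fun s hs => ?_
          simp only [max_eq_left hs.1.le]
      _ = _ := this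
      _ = _ := by
          refine setLIntegral_congr_fun measurableSet_Ioo fun s hs => ?_
          simp only [max_eq_left hs.1.le]
  have hsum : (∫⁻ s in Set.Ioo (0 : ℝ) 1, ∫⁻ x, (‖T s x‖₊ : ℝ≥0∞) ^ 2 ∂(μ h)) +
      ∫⁻ s in Set.Ioo (0 : ℝ) 1, V s ≤
      ENNReal.ofReal h * V 2 + ∫⁻ s in Set.Ioo (0 : ℝ) 1, V s := by
    rw [← lintegral_add_right _ hVmeas]
    calc _ = ∫⁻ s in Set.Ioo (0 : ℝ) 1, V (s + h) := by
          refine setLIntegral_congr_fun measurableSet_Ioo fun s hs => ?_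
          rw [add_comm s h, hVadd h s hh0 hs.1.le]
      _ = ∫⁻ s in Set.Ioo h (1 + h), V s := by
          have := (measurePreserving_add_right (volume : Measure ℝ) h).setLIntegral_comp_preimage
            (measurableSet_Ioo (a := h) (b := 1 + h)) hVmeas
          rw [← this]
          simp
      _ ≤ ∫⁻ s in Set.Ico 1 (1 + h) ∪ Set.Ioo 0 1, V s := by
          refine lintegral_mono_set fun s hs => ?_
          rcases lt_or_ge s 1 with h1 | h1
          · exact Or.inr ⟨hh0.trans_lt hs.1, h1⟩
          · exact Or.inl ⟨h1, hs.2⟩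
      _ ≤ (∫⁻ s in Set.Ico 1 (1 + h), V s) + ∫⁻ s in Set.Ioo (0 : ℝ) 1, V s :=
          lintegral_union_le _ _ _
      _ ≤ _ := by
          gcongr
          calc _ ≤ ∫⁻ s in Set.Ico 1 (1 + h), V 2 :=
                setLIntegral_mono measurable_const fun s hs => hVmono (by linarith [hs.2])
            _ = _ := by
                rw [setLIntegral_const, Real.volume_Ico, add_sub_cancel_left, mul_comm]
  have hfin : ∫⁻ s in Set.Ioo (0 : ℝ) 1, V s ≠ ⊤ := by
    refine ne_top_of_le_ne_top (hVfin 1).ne ?_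
    calc _ ≤ ∫⁻ s in Set.Ioo (0 : ℝ) 1, V 1 :=
          setLIntegral_mono measurable_const fun s hs => hVmono hs.2.le
      _ = V 1 := by rw [setLIntegral_const, Real.volume_Ioo]; simp
  calc ∫⁻ x, (‖x‖₊ : ℝ≥0∞) ^ 2 ∂(μ h)
      ≤ ∫⁻ x, (C * ∫⁻ s in Set.Ioo (0 : ℝ) 1, (‖T s x‖₊ : ℝ≥0∞) ^ 2) ∂(μ h) := lintegral_mono hC
    _ = C * ∫⁻ s in Set.Ioo (0 : ℝ) 1, ∫⁻ x, (‖T s x‖₊ : ℝ≥0∞) ^ 2 ∂(μ h) := by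
        rw [lintegral_const_mul' _ _ ENNReal.coe_ne_top, hswap]
    _ ≤ C * (ENNReal.ofReal h * V 2) := by
        gcongr
        exact ENNReal.le_of_add_le_add_right hfin hsum
    _ = ENNReal.ofReal (C * (V 2).toReal * h) := by
        rw [ENNReal.ofReal_mul (by positivity), ENNReal.ofReal_mul (by positivity),
          ENNReal.ofReal_toReal (hVfin 2).ne, ENNReal.ofReal_coe_nnreal]
        ring

end SecondMoments

section ExponentialEquation

/-- A continuous solution of `f' = ℓ f`, where the derivative is only taken along a family of
increments tending to zero, is an exponential. -/
lemma eq_exp_integral_of_tendsto_slope {ι : Type*} {l : Filter ι} [l.NeBot] {h : ι → ℝ}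
    (hh : Tendsto h l (𝓝[>] 0)) {f ℓ : ℝ → ℂ} {t : ℝ} (ht : 0 ≤ t)
    (hf : ContinuousOn f (Set.Icc 0 t)) (hf0 : f 0 = 1) (hℓ : Continuous ℓ)
    (hslope : ∀ s ∈ Set.Ico 0 t,
      Tendsto (fun i => (f (s + h i) - f s) / h i) l (𝓝 (ℓ s * f s))) :
    f t = Complex.exp (∫ s in (0 : ℝ)..t, ℓ s) := by
  set Λ : ℝ → ℂ := fun s => ∫ u in (0 : ℝ)..s, ℓ u with hΛ
  have hΛd (s : ℝ) : HasDerivAt Λ (ℓ s) s :=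
    intervalIntegral.integral_hasDerivAt_right (hℓ.intervalIntegrable _ _)
      (hℓ.stronglyMeasurableAtFilter _ _) hℓ.continuousAt
  set E : ℝ → ℂ := fun s => Complex.exp (-Λ s) with hE
  have hEd (s : ℝ) : HasDerivAt E (Complex.exp (-Λ s) * -ℓ s) s := (hΛd s).neg.cexp
  have hEc : Continuous E := continuous_iff_continuousAt.2 fun s => (hEd s).continuousAt
  set g : ℝ → ℂ := fun s => f s * E s - 1 with hg
  have hgc : ContinuousOn g (Set.Icc 0 t) := (hf.mul hEc.continuousOn).sub continuousOn_const
  have hadd (s : ℝ) : Tendsto (fun i => s + h i) l (𝓝[>] s) := by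
    refine tendsto_nhdsWithin_iff.2 ⟨?_, ?_⟩
    · simpa using (tendsto_nhds_of_tendsto_nhdsWithin hh).const_add s
    · filter_upwards [(tendsto_nhdsWithin_iff.1 hh).2] with i hi
      simpa using hi
  have hgslope (s : ℝ) (hs : s ∈ Set.Ico 0 t) :
      Tendsto (fun i => (g (s + h i) - g s) / h i) l (𝓝 0) := by
    have h1 : Tendsto (fun i => E (s + h i)) l (𝓝 (E s)) :=
      (hEc.tendsto s).comp (tendsto_nhds_of_tendsto_nhdsWithin (hadd s))
    have h2 : Tendsto (fun i => (E (s + h i) - E s) / h i) l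
        (𝓝 (Complex.exp (-Λ s) * -ℓ s)) := by
      have := ((hasDerivAt_iff_tendsto_slope.1 (hEd s)).mono_left
        (nhdsWithin_mono s fun x (hx : s < x) => hx.ne')).comp (hadd s)
      refine this.congr fun i => ?_
      simp only [Function.comp_apply, slope, vsub_eq_sub, add_sub_cancel_left, Complex.real_smul,
        Complex.ofReal_inv]
      rw [inv_mul_eq_div]
    have h3 := ((hslope s hs).mul h1).add (h2.const_mul (f s))
    have e : ℓ s * f s * E s + f s * (Complex.exp (-Λ s) * -ℓ s) = 0 := by
      simp only [hE]; ring
    rw [e] at h3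
    refine h3.congr fun i => ?_
    simp only [hg]
    ring
  have hbound (ε : ℝ) (hε : 0 < ε) : ‖g t‖ ≤ ε * t := by
    refine image_norm_le_of_liminf_right_slope_norm_lt_deriv_boundary (f' := fun _ => 0)
      (B := fun s => ε * s) (B' := fun _ => ε) hgc ?_ ?_ (by fun_prop) ?_ (fun _ _ _ => hε)
      ⟨ht, le_rfl⟩
    · intro s hs r hr
      have h1 : ∀ᶠ i in l, ‖(g (s + h i) - g s) / h i‖ < r := by
        have := (hgslope s hs).norm
        rw [norm_zero] at this
        exact this.eventually_lt_const hr
      refine (hadd s).frequently ?_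
      refine Eventually.frequently ?_
      filter_upwards [h1, (tendsto_nhdsWithin_iff.1 hh).2] with i hi hpos
      have hpos : 0 < h i := hpos
      refine lt_of_le_of_lt ?_ hi
      rw [norm_div, Complex.norm_real, Real.norm_of_nonneg hpos.le, slope_def_field,
        add_sub_cancel_left]
      gcongr
      exact norm_sub_norm_le _ _
    · simp [hg, hE, hΛ, hf0]
    · intro s _
      simpa using ((hasDerivAt_id s).const_mul ε).hasDerivWithinAt
  have hg0 : g t = 0 := by
    have hlim : Tendsto (fun ε : ℝ => ε * t) (𝓝[>] 0) (𝓝 (0 * t)) :=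
      (tendsto_nhdsWithin_of_tendsto_nhds tendsto_id).mul_const _
    have := ge_of_tendsto hlim (eventually_nhdsWithin_of_forall fun ε hε => hbound ε hε)
    rw [zero_mul] at this
    exact norm_le_zero_iff.1 this
  have h1 : f t * Complex.exp (-Λ t) = 1 := sub_eq_zero.1 hg0
  rw [Complex.exp_neg] at h1
  exact (mul_inv_eq_one₀ (Complex.exp_ne_zero _)).1 h1

end ExponentialEquation

section Differentiability

open ContinuousLinearMap

variable {H : Type*} [NormedAddCommGroup H] [InnerProductSpace ℝ H] [CompleteSpace H]
  [MeasurableSpace H] [BorelSpace H] [SecondCountableTopology H]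

lemma charFun_map_continuousLinearMap (μ : Measure H) (S : H →L[ℝ] H) (a : H) :
    charFun (μ.map S) a = charFun μ (adjoint S a) := by
  rw [charFun_apply, charFun_apply, integral_map S.continuous.aemeasurable (by fun_prop)]
  simp_rw [adjoint_inner_right]

lemma IsSC.charFun_add {T : ℝ → H →L[ℝ] H} {μ : ℝ → Measure H} (hμ : IsSC T μ) {r t : ℝ}
    (hr : 0 ≤ r) (ht : 0 ≤ t) (a : H) :
    charFun (μ (r + t)) a = charFun (μ r) (adjoint (T t) a) * charFun (μ t) a := by
  have _ := hμ.1 t ht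
  have _ := hμ.1 r hr
  have _ : IsProbabilityMeasure ((μ r).map (T t)) :=
    Measure.isProbabilityMeasure_map (T t).continuous.aemeasurable
  rw [hμ.2 r t hr ht, ← charFun_map_continuousLinearMap]
  exact charFun_conv a

lemma IsSC.continuousOn_charFun {T : ℝ → H →L[ℝ] H} {μ : ℝ → Measure H} (hμ : IsSC T μ)
    (h0 : ∀ t : ℝ, 0 ≤ t → ∫ x, x ∂(μ t) = 0) {K : ℝ} (hK : 0 ≤ K)
    (hm : ∀ h : ℝ, 0 ≤ h → h ≤ 1 →
      ∫⁻ x, (‖x‖₊ : ℝ≥0∞) ^ 2 ∂(μ h) ≤ ENNReal.ofReal (K * h)) {M R : ℝ}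
    (hTM : ∀ t, 0 ≤ t → t ≤ R → ‖T t‖ ≤ M) (a : H) :
    ContinuousOn (fun s => charFun (μ s) a) (Set.Icc 0 R) := by
  set D : ℝ := 3 * K * (M * ‖a‖) ^ 2 with hD
  have hle (p q : ℝ) (hp : 0 ≤ p) (hpq : p ≤ q) (hpR : p ≤ R) (hq : q - p ≤ 1) :
      ‖charFun (μ q) a - charFun (μ p) a‖ ≤ D * (q - p) := by
    have hqp : 0 ≤ q - p := sub_nonneg.2 hpq
    have _ := hμ.1 p hp
    have _ := hμ.1 (q - p) hqp
    have e := hμ.charFun_add hqp hp a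
    rw [sub_add_cancel] at e
    have e' : charFun (μ q) a - charFun (μ p) a =
        (charFun (μ (q - p)) (adjoint (T p) a) - 1) * charFun (μ p) a := by
      rw [e]; ring
    have h1 := norm_charFun_sub_one_le (μ (q - p)) (mul_nonneg hK hqp) (h0 _ hqp) (hm _ hqp hq)
      (adjoint (T p) a)
    have h2 : ‖adjoint (T p) a‖ ≤ M * ‖a‖ := by
      refine (adjoint (T p)).le_of_opNorm_le ?_ a
      rw [LinearIsometryEquiv.norm_map]
      exact hTM p hp hpR
    rw [e', norm_mul]
    calc _ ≤ (3 * (K * (q - p)) * ‖adjoint (T p) a‖ ^ 2) * 1 := by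
          gcongr
          exact norm_charFun_le_one a
      _ ≤ (3 * (K * (q - p)) * (M * ‖a‖) ^ 2) * 1 := by gcongr
      _ = D * (q - p) := by rw [hD]; ring
  have hD0 : 0 ≤ D := by positivity
  intro s hs
  rw [ContinuousWithinAt, tendsto_iff_norm_sub_tendsto_zero]
  have hlim : Tendsto (fun p : ℝ => D * |p - s|) (𝓝[Set.Icc 0 R] s) (𝓝 0) := by
    have : Tendsto (fun p : ℝ => D * |p - s|) (𝓝 s) (𝓝 (D * |s - s|)) :=
      Continuous.tendsto (by fun_prop) s
    simpa using this.mono_left nhdsWithin_le_nhds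
  refine squeeze_zero' (Eventually.of_forall fun p => norm_nonneg _) ?_ hlim
  filter_upwards [self_mem_nhdsWithin,
    nhdsWithin_le_nhds (Metric.closedBall_mem_nhds s one_pos)] with p hp hps
  rw [Metric.mem_closedBall, Real.dist_eq] at hps
  rcases le_total s p with h | h
  · rw [abs_of_nonneg (sub_nonneg.2 h)] at hps ⊢
    exact hle s p hs.1 h hs.2 hps
  · rw [abs_sub_comm, abs_of_nonneg (sub_nonneg.2 h)] at hps ⊢
    rw [norm_sub_rev]
    exact hle p s hp.1 h hp.2 hps

/-- A centered SC-semigroup whose second moments grow at most linearly near time zero is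
differentiable. -/
lemma IsSC.isDiffSC {T : ℝ → H →L[ℝ] H} (hT : IsC0 T) {c₀ b₀ : ℝ} (hc₀ : 0 ≤ c₀)
    (hb₀ : 0 ≤ b₀) (hbd : ∀ t : ℝ, 0 ≤ t → ‖T t‖ ≤ c₀ * Real.exp (b₀ * t))
    {μ : ℝ → Measure H} (hμ : IsSC T μ) (h0 : ∀ t : ℝ, 0 ≤ t → ∫ x, x ∂(μ t) = 0)
    {K : ℝ} (hK : 0 ≤ K)
    (hm : ∀ h : ℝ, 0 ≤ h → h ≤ 1 →
      ∫⁻ x, (‖x‖₊ : ℝ≥0∞) ^ 2 ∂(μ h) ≤ ENNReal.ofReal (K * h)) : IsDiffSC T μ := by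
  let U : Ultrafilter ℕ := hyperfilter ℕ
  have hU : (U : Filter ℕ) ≤ atTop := by
    rw [← Nat.cofinite_eq_atTop]
    exact hyperfilter_le_cofinite
  let n : ℕ → ℕ := fun i => i + 1
  have hnpos (i : ℕ) : (0 : ℝ) < n i := by positivity
  have hn : Tendsto n U atTop := (tendsto_add_atTop_nat 1).mono_left hU
  let h : ℕ → ℝ := fun i => (n i : ℝ)⁻¹
  have hhpos (i : ℕ) : 0 < h i := inv_pos.2 (hnpos i)
  have hh1 (i : ℕ) : h i ≤ 1 := by
    refine inv_le_one_of_one_le₀ ?_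
    exact_mod_cast Nat.le_add_left 1 i
  have hh : Tendsto h U (𝓝[>] 0) :=
    tendsto_nhdsWithin_iff.2 ⟨(tendsto_inv_atTop_nhds_zero_nat (𝕜 := ℝ)).comp hn,
      Eventually.of_forall hhpos⟩
  let ν : ℕ → Measure H := fun i => μ (h i)
  have hν (i : ℕ) : IsProbabilityMeasure (ν i) := hμ.1 _ (hhpos i).le
  have hν0 (i : ℕ) : ∫ x, x ∂(ν i) = 0 := h0 _ (hhpos i).le
  have hνm (i : ℕ) : ∫⁻ x, (‖x‖₊ : ℝ≥0∞) ^ 2 ∂(ν i) ≤ ENNReal.ofReal (K / n i) :=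
    hm _ (hhpos i).le (hh1 i)
  let u : ℕ → H → ℂ := fun i a => (n i : ℂ) * (charFun (ν i) a - 1)
  have hudiff (i : ℕ) (a b : H) :
      ‖u i a - u i b‖ ≤ K * (3 * ‖a - b‖ ^ 2 + ‖b‖ * ‖a - b‖) := by
    have := norm_charFun_sub_charFun_le (ν i) (div_nonneg hK (hnpos i).le) (hν0 i) (hνm i) a b
    have e : u i a - u i b = (n i : ℂ) * (charFun (ν i) a - charFun (ν i) b) := by
      simp only [u]; ring
    rw [e, norm_mul, Complex.norm_natCast]
    calc _ ≤ (n i : ℝ) * (K / n i * (3 * ‖a - b‖ ^ 2 + ‖b‖ * ‖a - b‖)) := by gcongr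
      _ = _ := by have := (hnpos i).ne'; field_simp
  have hu0 (i : ℕ) : u i 0 = 0 := by simp [u]
  have hlim (a : H) : ∃ z, Tendsto (fun i => u i a) U (𝓝 z) := by
    obtain ⟨z, -, hz⟩ := (isCompact_closedBall (0 : ℂ) (K * (3 * ‖a‖ ^ 2))).ultrafilter_le_nhds
      (U.map fun i => u i a) (by
        rw [le_principal_iff, Ultrafilter.coe_map, mem_map]
        refine univ_mem' fun i => ?_
        have := hudiff i a 0
        simpa [hu0] using this)
    exact ⟨z, hz⟩
  choose L hL using hlim
  have hLdiff (a b : H) : ‖L a - L b‖ ≤ K * (3 * ‖a - b‖ ^ 2 + ‖b‖ * ‖a - b‖) :=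
    le_of_tendsto ((hL a).sub (hL b)).norm (Eventually.of_forall fun i => hudiff i a b)
  have hL0 : L 0 = 0 := by
    refine tendsto_nhds_unique (hL 0) ?_
    simp only [hu0]
    exact tendsto_const_nhds
  have hLc : Continuous L := by
    refine continuous_iff_continuousAt.2 fun b => ?_
    rw [ContinuousAt, tendsto_iff_norm_sub_tendsto_zero]
    refine squeeze_zero (fun _ => norm_nonneg _) (fun a => hLdiff a b) ?_
    have : Tendsto (fun a : H => K * (3 * ‖a - b‖ ^ 2 + ‖b‖ * ‖a - b‖)) (𝓝 b)
        (𝓝 (K * (3 * ‖b - b‖ ^ 2 + ‖b‖ * ‖b - b‖))) := Continuous.tendsto (by fun_prop) b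
    simpa using this
  have hroot (m : ℕ) (hm1 : 1 ≤ m) := exists_charFun_eq_exp_div U hn (fun i => Nat.le_add_left 1 i)
    ν hν hν0 hK hνm hL hm1
  obtain ⟨ν₀, hp, hmean, hsq, hchar⟩ := hroot 1 le_rfl
  refine ⟨ν₀, L, hp, hmean, hsq.trans_lt ENNReal.ofReal_lt_top, fun m hm1 => ?_, hLc, hL0,
    fun a => ?_, fun t ht a => ?_⟩
  · obtain ⟨ν₁, hp₁, -, -, hchar₁⟩ := hroot m hm1
    have _ := isProbabilityMeasure_convPow ν₁ m
    refine ⟨ν₁, hp₁, Measure.ext_of_charFun (funext fun a => ?_)⟩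
    have hm0 : (m : ℂ) ≠ 0 := Nat.cast_ne_zero.2 (by omega)
    rw [charFun_convPow, hchar, hchar₁, ← Complex.exp_nat_mul]
    congr 1
    push_cast
    field_simp
  · have := hchar a
    rw [Nat.cast_one, div_one] at this
    exact this.symm
  · obtain ⟨M, -, hTM⟩ := exists_norm_le_of_le_exp hc₀ hb₀ hbd t
    have hadj : Continuous fun s : ℝ => adjoint (T (max s 0)) a :=
      (hT.continuousOn_adjoint hc₀ hb₀ hbd a).comp_continuous (by fun_prop)
        fun s => le_max_right s 0
    have hzero : charFun (μ 0) a = 1 := by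
      have _ := hμ.1 0 le_rfl
      have := norm_charFun_sub_one_le (μ 0) le_rfl (h0 0 le_rfl)
        (by simpa using hm 0 le_rfl zero_le_one) a
      rw [mul_zero, zero_mul] at this
      exact sub_eq_zero.1 (norm_le_zero_iff.1 this)
    have := eq_exp_integral_of_tendsto_slope (l := (U : Filter ℕ)) hh ht
      (hμ.continuousOn_charFun h0 hK hm hTM a) hzero (hLc.comp hadj) fun s hs => by
        have h1 := (hL (adjoint (T s) a)).mul_const (charFun (μ s) a)
        simp only [Function.comp_apply, max_eq_left hs.1]
        refine h1.congr fun i => ?_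
        rw [add_comm s, hμ.charFun_add (hhpos i).le hs.1]
        simp only [u, ν, h, Complex.ofReal_inv, Complex.ofReal_natCast, div_inv_eq_mul]
        ring
    change charFun (μ t) a = _
    rw [this, intervalIntegral.integral_of_le ht, integral_Ioc_eq_integral_Ioo]
    congr 1
    refine setIntegral_congr_fun measurableSet_Ioo fun s hs => ?_
    simp only [Function.comp_apply, max_eq_left hs.1.le]

end Differentiability

section CompoundPoisson

variable {H : Type*} [NormedAddCommGroup H] [InnerProductSpace ℝ H] [CompleteSpace H]
  [MeasurableSpace H] [BorelSpace H] [SecondCountableTopology H]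

/-- The compound Poisson distribution with a given centered jump measure. -/
lemma exists_charFun_eq_exp_charFun_sub (κ : Measure H) [IsFiniteMeasure κ]
    (h0 : ∫ x, x ∂κ = 0) (h2 : ∫⁻ x, (‖x‖₊ : ℝ≥0∞) ^ 2 ∂κ < ⊤) :
    ∃ ρ : Measure H, IsProbabilityMeasure ρ ∧ ∫ x, x ∂ρ = 0 ∧
      ∫⁻ x, (‖x‖₊ : ℝ≥0∞) ^ 2 ∂ρ < ⊤ ∧
      ∀ a, charFun ρ a = Complex.exp (charFun κ a - κ.real Set.univ) := by
  set K : ℝ := (∫⁻ x, (‖x‖₊ : ℝ≥0∞) ^ 2 ∂κ).toReal with hKdef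
  have hK : 0 ≤ K := ENNReal.toReal_nonneg
  set θ : ℝ := κ.real Set.univ with hθ
  have hθ0 : 0 ≤ θ := measureReal_nonneg
  let n : ℕ → ℕ := fun i => i + (⌈θ⌉₊ + 1)
  have hn1 (i : ℕ) : 1 ≤ n i := by simp only [n]; omega
  have hnpos (i : ℕ) : (0 : ℝ) < n i := by exact_mod_cast hn1 i
  have hθn (i : ℕ) : θ / n i ≤ 1 := by
    rw [div_le_one (hnpos i)]
    calc θ ≤ ⌈θ⌉₊ := Nat.le_ceil θ
      _ ≤ n i := by exact_mod_cast (by simp only [n]; omega)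
  let lam : ℕ → Measure H := fun i =>
    ENNReal.ofReal (1 - θ / n i) • Measure.dirac 0 + ENNReal.ofReal (1 / n i) • κ
  have hfin (i : ℕ) : IsFiniteMeasure (ENNReal.ofReal (1 / n i) • κ) :=
    Measure.smul_finite κ ENNReal.ofReal_ne_top
  have hfin' (i : ℕ) : IsFiniteMeasure (ENNReal.ofReal (1 - θ / n i) • Measure.dirac (0 : H)) :=
    Measure.smul_finite _ ENNReal.ofReal_ne_top
  have hprob (i : ℕ) : IsProbabilityMeasure (lam i) := by
    constructor
    simp only [lam, Measure.coe_add, Measure.coe_smul, Pi.add_apply, Pi.smul_apply, measure_univ,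
      smul_eq_mul, mul_one]
    rw [← ofReal_measureReal (μ := κ), ← hθ, ← ENNReal.ofReal_mul (by positivity),
      ← ENNReal.ofReal_add (sub_nonneg.2 (hθn i)) (by positivity), ← ENNReal.ofReal_one]
    congr 1
    ring
  have hid := integrable_id_of_lintegral_sq_lt_top h2
  have hmean (i : ℕ) : ∫ x, x ∂(lam i) = 0 := by
    simp only [lam]
    rw [integral_add_measure ((integrable_dirac (by simp)).smul_measure ENNReal.ofReal_ne_top)
      (hid.smul_measure ENNReal.ofReal_ne_top), integral_smul_measure, integral_smul_measure,
      integral_dirac, h0, smul_zero, smul_zero, add_zero]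
  have hsq (i : ℕ) : ∫⁻ x, (‖x‖₊ : ℝ≥0∞) ^ 2 ∂(lam i) ≤ ENNReal.ofReal (K / n i) := by
    simp only [lam]
    rw [show K / n i = 1 / n i * K by ring, ENNReal.ofReal_mul (by positivity), hKdef,
      ENNReal.ofReal_toReal h2.ne, lintegral_add_measure, lintegral_smul_measure,
      lintegral_smul_measure, lintegral_dirac' _ (by fun_prop)]
    simp
  have hchar (i : ℕ) (a : H) : (n i : ℂ) * (charFun (lam i) a - 1) = charFun κ a - θ := by
    have e : charFun (lam i) a = (1 - θ / n i : ℝ) + (1 / n i : ℝ) * charFun κ a := by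
      simp only [lam]
      rw [charFun_apply, integral_add_measure (integrable_exp_inner_mul_I _ a)
        (integrable_exp_inner_mul_I _ a), integral_smul_measure, integral_smul_measure,
        integral_dirac, ENNReal.toReal_ofReal (sub_nonneg.2 (hθn i)),
        ENNReal.toReal_ofReal (by positivity), ← charFun_apply]
      simp
    have hne : (n i : ℂ) ≠ 0 := Nat.cast_ne_zero.2 (Nat.one_le_iff_ne_zero.1 (hn1 i))
    rw [e]
    push_cast
    field_simp
    ring
  have hn : Tendsto n (hyperfilter ℕ : Filter ℕ) atTop := by
    refine (tendsto_add_atTop_nat _).mono_left ?_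
    rw [← Nat.cofinite_eq_atTop]
    exact hyperfilter_le_cofinite
  obtain ⟨ρ, hρ, hρ0, hρ2, hρc⟩ := exists_charFun_eq_exp_div (hyperfilter ℕ) hn hn1 lam hprob hmean
    hK hsq (Ψ := fun a => charFun κ a - θ) (fun a => by simp only [hchar]; exact tendsto_const_nhds)
    le_rfl
  refine ⟨ρ, hρ, hρ0, hρ2.trans_lt ENNReal.ofReal_lt_top, fun a => ?_⟩
  rw [hρc a, Nat.cast_one, div_one]

/-- The compound Poisson distribution of the symmetrization of a square integrable function. -/
lemma exists_charFun_eq_exp_integral_cos {Ω : Type*} [MeasurableSpace Ω] (σ : Measure Ω)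
    [IsFiniteMeasure σ] {X : Ω → H} (hX : Measurable X)
    (h2 : ∫⁻ s, (‖X s‖₊ : ℝ≥0∞) ^ 2 ∂σ < ⊤) :
    ∃ ρ : Measure H, IsProbabilityMeasure ρ ∧ ∫ x, x ∂ρ = 0 ∧
      ∫⁻ x, (‖x‖₊ : ℝ≥0∞) ^ 2 ∂ρ < ⊤ ∧
      ∀ a, charFun ρ a = Complex.exp (∫ s, (Complex.cos (⟪X s, a⟫_ℝ : ℝ) - 1) ∂σ) := by
  set κ : Measure H := (2⁻¹ : ℝ≥0∞) • (σ.map X + σ.map fun s => -X s) with hκ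
  have _ : IsFiniteMeasure κ := Measure.smul_finite _ (by simp)
  have hl (Y : Ω → H) (hY : Measurable Y) (hYX : ∀ s, ‖Y s‖₊ = ‖X s‖₊) :
      ∫⁻ x, (‖x‖₊ : ℝ≥0∞) ^ 2 ∂(σ.map Y) = ∫⁻ s, (‖X s‖₊ : ℝ≥0∞) ^ 2 ∂σ := by
    rw [lintegral_map (by fun_prop) hY]
    simp_rw [hYX]
  have hXn : Measurable fun s => -X s := hX.neg
  have hl1 := hl X hX fun s => rfl
  have hl2 := hl (fun s => -X s) hXn fun s => nnnorm_neg _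
  have hsq : ∫⁻ x, (‖x‖₊ : ℝ≥0∞) ^ 2 ∂κ < ⊤ := by
    rw [hκ, lintegral_smul_measure, lintegral_add_measure, hl1, hl2]
    exact ENNReal.mul_lt_top (by simp) (ENNReal.add_lt_top.2 ⟨h2, h2⟩)
  have hmean : ∫ x, x ∂κ = 0 := by
    rw [hκ, integral_smul_measure,
      integral_add_measure (integrable_id_of_lintegral_sq_lt_top (hl1 ▸ h2))
        (integrable_id_of_lintegral_sq_lt_top (hl2 ▸ h2)),
      integral_map hX.aemeasurable (by fun_prop), integral_map hXn.aemeasurable (by fun_prop),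
      integral_neg, add_neg_cancel, smul_zero]
  obtain ⟨ρ, hρ, hρ0, hρ2, hρc⟩ := exists_charFun_eq_exp_charFun_sub κ hmean hsq
  refine ⟨ρ, hρ, hρ0, hρ2, fun a => ?_⟩
  have hmass : κ.real Set.univ = σ.real Set.univ := by
    simp only [hκ, measureReal_def, Measure.coe_smul, Measure.coe_add, Pi.smul_apply, Pi.add_apply,
      Measure.map_apply hX MeasurableSet.univ, Measure.map_apply hXn MeasurableSet.univ,
      Set.preimage_univ, smul_eq_mul]
    rw [← two_mul, ← mul_assoc, ENNReal.inv_mul_cancel (by simp) (by simp), one_mul]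
  have hi (Y : Ω → H) (hY : Measurable Y) :
      Integrable (fun s => Complex.exp ((⟪Y s, a⟫_ℝ : ℂ) * Complex.I)) σ :=
    Integrable.of_bound (by fun_prop) 1
      (ae_of_all _ fun s => (Complex.norm_exp_ofReal_mul_I _).le)
  have hc : charFun κ a = ∫ s, Complex.cos (⟪X s, a⟫_ℝ : ℝ) ∂σ := by
    rw [charFun_apply, hκ, integral_smul_measure,
      integral_add_measure (integrable_exp_inner_mul_I _ a) (integrable_exp_inner_mul_I _ a),
      integral_map hX.aemeasurable (by fun_prop), integral_map hXn.aemeasurable (by fun_prop),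
      ← integral_add (hi X hX) (hi _ hXn), ← integral_smul]
    congr with s
    rw [Complex.cos, inner_neg_left]
    simp
    ring
  have hcos : Integrable (fun s => Complex.cos (⟪X s, a⟫_ℝ : ℝ)) σ := by
    refine Integrable.of_bound (by fun_prop) 1 (ae_of_all _ fun s => ?_)
    rw [← Complex.ofReal_cos, Complex.norm_real]
    exact Real.abs_cos_le_one _
  rw [hρc, integral_sub hcos (integrable_const _), hc, hmass]
  simp

end CompoundPoisson

section EntrancePaths

open ContinuousLinearMap (adjoint)

variable {H : Type*} [NormedAddCommGroup H] [InnerProductSpace ℝ H]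
  {T : ℝ → H →L[ℝ] H} {x : ℝ → H}

lemma IsEntrance.continuousOn (hT : IsC0 T) (hx : IsEntrance T x) :
    ContinuousOn x (Set.Ioi 0) := by
  intro s hs
  have hs : 0 < s := hs
  have h1 : Continuous fun p => T (max (p - s / 2) 0) (x (s / 2)) :=
    (hT.continuous_max _).comp (continuous_id.sub continuous_const)
  refine (h1.continuousAt.congr ?_).continuousWithinAt
  filter_upwards [lt_mem_nhds (half_lt_self hs)] with p hp
  rw [max_eq_left (sub_nonneg.2 (le_of_lt hp)), ← hx.2 _ _ (half_pos hs) (sub_pos.2 hp),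
    add_sub_cancel]

lemma MemHt.lintegral_lt_top (hT : IsC0 T) (hx : MemHt T x) (t : ℝ) :
    ∫⁻ s in Set.Ioo 0 t, (‖x s‖₊ : ℝ≥0∞) ^ 2 < ⊤ := by
  obtain ⟨hx, l, hl, hfin⟩ := hx
  obtain ⟨C, hC⟩ := (isCompact_Icc (a := l / 2) (b := max t l)).exists_bound_of_continuousOn
    ((hx.continuousOn hT).mono fun s hs => (half_pos hl).trans_le hs.1)
  have hsub : Set.Ioo 0 t ⊆ Set.Ioo 0 l ∪ Set.Icc (l / 2) (max t l) := by
    intro s hs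
    by_cases h : s < l
    · exact Or.inl ⟨hs.1, h⟩
    · exact Or.inr ⟨by linarith, hs.2.le.trans (le_max_left _ _)⟩
  have hbound : ∫⁻ s in Set.Icc (l / 2) (max t l), (‖x s‖₊ : ℝ≥0∞) ^ 2 < ⊤ := by
    refine lt_of_le_of_lt (setLIntegral_mono (g := fun _ => ENNReal.ofReal C ^ 2)
      measurable_const fun s hs => ?_) ?_
    · gcongr
      rw [← enorm_eq_nnnorm, ← ofReal_norm]
      exact ENNReal.ofReal_le_ofReal (hC s hs)
    · rw [setLIntegral_const]
      exact ENNReal.mul_lt_top (by finiteness) measure_Icc_lt_top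
  calc ∫⁻ s in Set.Ioo 0 t, (‖x s‖₊ : ℝ≥0∞) ^ 2
      ≤ ∫⁻ s in Set.Ioo 0 l ∪ Set.Icc (l / 2) (max t l), (‖x s‖₊ : ℝ≥0∞) ^ 2 :=
        lintegral_mono_set hsub
    _ ≤ _ := lintegral_union_le _ _ _
    _ < ⊤ := ENNReal.add_lt_top.2 ⟨hfin, hbound⟩

lemma eq_of_exp_intervalIntegral_eq {f g : ℝ → ℂ} (hf : Continuous f)
    (hg : ContinuousOn g (Set.Ioi 0)) (hgi : ∀ p q, IntervalIntegrable g volume p q)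
    (h : ∀ t, 0 ≤ t → Complex.exp (∫ s in (0 : ℝ)..t, f s) = Complex.exp (∫ s in (0 : ℝ)..t, g s))
    {s : ℝ} (hs : 0 < s) : f s = g s := by
  have hdf := (intervalIntegral.integral_hasDerivAt_right (hf.intervalIntegrable 0 s)
    (hf.stronglyMeasurableAtFilter _ _) hf.continuousAt).cexp
  have hdg := (intervalIntegral.integral_hasDerivAt_right (hgi 0 s)
    (hg.stronglyMeasurableAtFilter isOpen_Ioi s hs)
    (hg.continuousAt (Ioi_mem_nhds hs))).cexp
  have heq : (fun t => Complex.exp (∫ s in (0 : ℝ)..t, f s)) =ᶠ[𝓝 s]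
      fun t => Complex.exp (∫ s in (0 : ℝ)..t, g s) := by
    filter_upwards [lt_mem_nhds hs] with t ht using h t (le_of_lt ht)
  have e := (hdf.congr_of_eventuallyEq heq.symm).unique hdg
  rw [h s hs.le] at e
  exact mul_left_cancel₀ (Complex.exp_ne_zero _) e

variable [MeasurableSpace H]

lemma not_ae_eq_zero_of_charFun {ρ : Measure H} [IsProbabilityMeasure ρ] {w : H} (hw : w ≠ 0)
    (h : ∀ a, charFun ρ a = Complex.exp (Complex.cos (⟪w, a⟫_ℝ : ℝ) - 1)) :
    ¬ ∀ᵐ y ∂ρ, y = 0 := by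
  intro h0
  have e := h ((π / ‖w‖ ^ 2) • w)
  have hπ : ⟪w, (π / ‖w‖ ^ 2) • w⟫_ℝ = π := by
    rw [real_inner_smul_right, real_inner_self_eq_norm_sq]
    field_simp [norm_ne_zero_iff.2 hw]
  rw [hπ, charFun_apply, integral_congr_ae (g := fun _ => (1 : ℂ))
    (by filter_upwards [h0] with y hy; simp [hy])] at e
  rw [integral_const, probReal_univ, one_smul, ← Complex.ofReal_cos, Real.cos_pi] at e
  have e' : (1 : ℝ) = Real.exp (-1 - 1) := by exact_mod_cast e
  exact absurd e'.symm (Real.exp_lt_one_iff.2 (by norm_num)).ne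

/-- A law whose images under `T s` all live on the lines spanned by the path closes the path. -/
lemma IsEntrance.closable_of_ae_mem_span (hT : IsC0 T) (hx : IsEntrance T x) {ν : Measure H}
    (hspan : ∀ s, 0 < s → ∀ᵐ y ∂ν, ∃ c : ℝ, T s y = c • x s)
    (hne : ∀ s, 0 < s → x s ≠ 0 → ¬ ∀ᵐ y ∂ν, T s y = 0) :
    ∃ x₀ : H, ∀ s : ℝ, 0 < s → x s = T s x₀ := by
  by_cases hzero : ∀ s, 0 < s → x s = 0
  · exact ⟨0, fun s hs => by rw [hzero s hs, map_zero]⟩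
  push Not at hzero
  obtain ⟨s₁, hs₁, hxs₁⟩ := hzero
  have hall : ∀ᵐ y ∂ν, ∀ n : ℕ, ∃ c : ℝ, T (s₁ / (n + 2)) y = c • x (s₁ / (n + 2)) :=
    ae_all_iff.2 fun n => hspan _ (by positivity)
  obtain ⟨y, hy, hyne⟩ : ∃ y, (∀ n : ℕ, ∃ c : ℝ, T (s₁ / (n + 2)) y = c • x (s₁ / (n + 2))) ∧
      T s₁ y ≠ 0 := by
    by_contra! hcon
    exact hne s₁ hs₁ hxs₁ (hall.mono hcon)
  choose c hc using hy
  have hpos (n : ℕ) : 0 < s₁ / ((n : ℝ) + 2) := by positivity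
  have hlt (n : ℕ) : s₁ / ((n : ℝ) + 2) < s₁ := div_lt_self hs₁ (by linarith [n.cast_nonneg (α := ℝ)])
  have key (n : ℕ) (s : ℝ) (hs : s₁ / ((n : ℝ) + 2) < s) : T s y = c n • x s := by
    have e := hx.2 _ _ (hpos n) (sub_pos.2 hs)
    have e' := hT.add_apply (sub_pos.2 hs).le (hpos n).le y
    rw [add_sub_cancel] at e
    rw [sub_add_cancel, hc, map_smul, ← e] at e'
    exact e'
  have hcn (n : ℕ) : c n = c 0 :=
    smul_left_injective ℝ hxs₁ ((key n s₁ (hlt n)).symm.trans (key 0 s₁ (hlt 0)))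
  have hc0 : c 0 ≠ 0 := fun h => hyne (by rw [key 0 s₁ (hlt 0), h, zero_smul])
  refine ⟨(c 0)⁻¹ • y, fun s hs => ?_⟩
  obtain ⟨n, hn⟩ := exists_nat_gt (s₁ / s)
  have hns : s₁ / ((n : ℝ) + 2) < s := by
    rw [div_lt_iff₀ (by positivity)]
    rw [div_lt_iff₀ hs] at hn
    nlinarith
  rw [map_smul, key n s hns, hcn n, inv_smul_smul₀ hc0]

variable [BorelSpace H]

lemma IsEntrance.measurable (hT : IsC0 T) (hx : IsEntrance T x) : Measurable x := by
  refine measurable_of_continuousOn_compl_singleton 0 fun s hs => ?_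
  refine ContinuousAt.continuousWithinAt ?_
  rcases lt_or_gt_of_ne hs with h | h
  · refine ContinuousAt.congr (f := fun _ => 0) continuousAt_const ?_
    filter_upwards [gt_mem_nhds h] with p hp
    exact (hx.1 p (le_of_lt hp)).symm
  · exact (hx.continuousOn hT).continuousAt (Ioi_mem_nhds h)

variable [SecondCountableTopology H]

lemma intervalIntegrable_cos_inner_sub_one (hx : Measurable x) (a : H) (p q : ℝ) :
    IntervalIntegrable (fun s => Complex.cos (⟪x s, a⟫_ℝ : ℝ) - 1) volume p q := by
  refine (intervalIntegrable_const (c := (2 : ℝ))).mono_fun (by fun_prop) (ae_of_all _ fun s => ?_)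
  refine (norm_sub_le _ _).trans ?_
  rw [← Complex.ofReal_cos, Complex.norm_real]
  have := Real.abs_cos_le_one ⟪x s, a⟫_ℝ
  simp only [norm_eq_abs, norm_one, abs_two]
  linarith

variable [CompleteSpace H]

lemma ae_mem_span_of_charFun {ρ : Measure H} [IsProbabilityMeasure ρ] {w : H}
    (h : ∀ a, charFun ρ a = Complex.exp (Complex.cos (⟪w, a⟫_ℝ : ℝ) - 1)) :
    ∀ᵐ y ∂ρ, ∃ c : ℝ, y = c • w := by
  set P : H →L[ℝ] H := (ℝ ∙ w)ᗮ.starProjection with hP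
  have hdirac : ρ.map P = Measure.dirac 0 := by
    have _ : IsProbabilityMeasure (ρ.map P) :=
      Measure.isProbabilityMeasure_map P.continuous.aemeasurable
    refine Measure.ext_of_charFun (funext fun a => ?_)
    have hwP : ⟪w, adjoint P a⟫_ℝ = 0 := by
      rw [ContinuousLinearMap.adjoint_inner_right, hP,
        Submodule.starProjection_orthogonal_apply_eq_zero (Submodule.mem_span_singleton_self w),
        inner_zero_left]
    rw [charFun_map_continuousLinearMap, h, hwP, charFun_dirac]
    simp
  have hae : ∀ᵐ y ∂(ρ.map P), y = 0 := by
    rw [hdirac, ae_dirac_eq]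
    simp
  filter_upwards [ae_of_ae_map P.continuous.aemeasurable hae] with y hy
  rw [hP, Submodule.starProjection_apply_eq_zero_iff, Submodule.orthogonal_orthogonal] at hy
  obtain ⟨c, hc⟩ := Submodule.mem_span_singleton.1 hy
  exact ⟨c, hc.symm⟩

/-- Any locally square integrable entrance path drives a centered SC-semigroup. -/
lemma MemHt.exists_isSC (hT : IsC0 T) (hx : MemHt T x) :
    ∃ μ : ℝ → Measure H, IsSC T μ ∧ (∀ t : ℝ, 0 ≤ t → ∫ y, y ∂(μ t) = 0) ∧
      (∀ t : ℝ, 0 ≤ t → ∫⁻ y, (‖y‖₊ : ℝ≥0∞) ^ 2 ∂(μ t) < ⊤) ∧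
      ∀ t : ℝ, 0 ≤ t → ∀ a, charFun (μ t) a =
        Complex.exp (∫ s in (0 : ℝ)..t, (Complex.cos (⟪x s, a⟫_ℝ : ℝ) - 1)) := by
  have hxm := hx.1.measurable hT
  choose μ hμ h0 h2 hc using fun t : ℝ => exists_charFun_eq_exp_integral_cos
    (volume.restrict (Set.Ioo 0 t)) hxm (hx.lintegral_lt_top hT t)
  have hchar (t : ℝ) (ht : 0 ≤ t) (a : H) : charFun (μ t) a =
      Complex.exp (∫ s in (0 : ℝ)..t, (Complex.cos (⟪x s, a⟫_ℝ : ℝ) - 1)) := by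
    rw [hc, intervalIntegral.integral_of_le ht, integral_Ioc_eq_integral_Ioo]
  refine ⟨μ, ⟨fun t _ => hμ t, fun r t hr ht => ?_⟩, fun t _ => h0 t, fun t _ => h2 t, hchar⟩
  have _ : IsProbabilityMeasure ((μ r).map (T t)) :=
    Measure.isProbabilityMeasure_map (T t).continuous.aemeasurable
  have _ : IsFiniteMeasure (mconv ((μ r).map (T t)) (μ t)) :=
    inferInstanceAs (IsFiniteMeasure (((μ r).map (T t)).conv (μ t)))
  refine Measure.ext_of_charFun (funext fun a => ?_)
  refine Eq.trans ?_ (charFun_conv (μ := (μ r).map (T t)) (ν := μ t) a).symm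
  rw [charFun_map_continuousLinearMap, hchar _ (add_nonneg hr ht), hchar r hr, hchar t ht,
    ← Complex.exp_add]
  congr 1
  rw [← intervalIntegral.integral_add_adjacent_intervals
    (intervalIntegrable_cos_inner_sub_one hxm a 0 t)
    (intervalIntegrable_cos_inner_sub_one hxm a t (r + t)), add_comm]
  congr 1
  have e := intervalIntegral.integral_comp_add_right (a := 0) (b := r)
    (fun s => Complex.cos (⟪x s, a⟫_ℝ : ℝ) - 1) t
  rw [zero_add] at e
  rw [← e, intervalIntegral.integral_of_le hr, intervalIntegral.integral_of_le hr]
  refine setIntegral_congr_fun measurableSet_Ioc fun s hs => ?_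
  rcases ht.eq_or_lt with rfl | ht
  · simp [hT.1, ContinuousLinearMap.adjoint_inner_right]
  · simp only [ContinuousLinearMap.adjoint_inner_right, hx.1.2 s t hs.1 ht]

lemma MemHt.closable (hT : IsC0 T) {c₀ b₀ : ℝ} (hc₀ : 0 ≤ c₀) (hb₀ : 0 ≤ b₀)
    (hbd : ∀ t : ℝ, 0 ≤ t → ‖T t‖ ≤ c₀ * Real.exp (b₀ * t)) (hx : MemHt T x)
    (hdiff : ∀ μ : ℝ → Measure H, IsSC T μ → (∀ t : ℝ, 0 ≤ t → ∫ y, y ∂(μ t) = 0) →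
      (∀ t : ℝ, 0 ≤ t → ∫⁻ y, (‖y‖₊ : ℝ≥0∞) ^ 2 ∂(μ t) < ⊤) → IsDiffSC T μ) :
    ∃ x₀ : H, ∀ s : ℝ, 0 < s → x s = T s x₀ := by
  obtain ⟨μ, hμ, h0, h2, hchar⟩ := hx.exists_isSC hT
  obtain ⟨ν, L, hν, -, -, -, hL, -, hLν, hLμ⟩ := hdiff μ hμ h0 h2
  have hcos (s : ℝ) (hs : 0 < s) (a : H) :
      L (adjoint (T s) a) = Complex.cos (⟪x s, a⟫_ℝ : ℝ) - 1 := by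
    have hf : Continuous fun s => L (adjoint (T (max s 0)) a) :=
      hL.comp ((hT.continuousOn_adjoint hc₀ hb₀ hbd a).comp_continuous
        (continuous_id.max continuous_const) fun s => Set.mem_Ici.2 (le_max_right _ _))
    have hg : ContinuousOn (fun s => Complex.cos (⟪x s, a⟫_ℝ : ℝ) - 1) (Set.Ioi 0) := by
      have := hx.1.continuousOn hT
      fun_prop
    have e := eq_of_exp_intervalIntegral_eq hf hg
      (intervalIntegrable_cos_inner_sub_one (hx.1.measurable hT) a) (fun t ht => by
        rw [← hchar t ht a]
        refine Eq.trans ?_ (hLμ t ht a).symm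
        rw [intervalIntegral.integral_of_le ht, integral_Ioc_eq_integral_Ioo]
        congr 1
        refine setIntegral_congr_fun measurableSet_Ioo fun s hs => ?_
        simp only [max_eq_left hs.1.le]) hs
    simpa only [max_eq_left hs.le] using e
  have hmap (s : ℝ) (hs : 0 < s) (a : H) :
      charFun (ν.map (T s)) a = Complex.exp (Complex.cos (⟪x s, a⟫_ℝ : ℝ) - 1) := by
    rw [charFun_map_continuousLinearMap, ← hcos s hs a]
    exact (hLν _).symm
  have hprob (s : ℝ) : IsProbabilityMeasure (ν.map (T s)) :=
    Measure.isProbabilityMeasure_map (T s).continuous.aemeasurable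
  refine hx.1.closable_of_ae_mem_span hT (ν := ν)
    (fun s hs => ae_of_ae_map (T s).continuous.aemeasurable (ae_mem_span_of_charFun (hmap s hs)))
    fun s hs hxs hae => not_ae_eq_zero_of_charFun hxs (hmap s hs) ?_
  exact (ae_map_iff (T s).continuous.aemeasurable (measurableSet_singleton 0)).2 hae

end EntrancePaths

/-- **Theorem 3.1.** All centered SC-semigroups associated with `(T_t)` with finite
second moments are differentiable if and only if all locally square integrable
entrance paths for `(T_t)` are closable. -/
theorem all_sc_differentiable_iff_all_entrance_paths_closable
    {H : Type*} [NormedAddCommGroup H] [InnerProductSpace ℝ H] [CompleteSpace H]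
    [MeasurableSpace H] [BorelSpace H] [SecondCountableTopology H]
    (T : ℝ → H →L[ℝ] H) (c₀ b₀ : ℝ) (hc₀ : 0 ≤ c₀) (hb₀ : 0 ≤ b₀)
    (hT : IsC0 T) (hbd : ∀ t : ℝ, 0 ≤ t → ‖T t‖ ≤ c₀ * Real.exp (b₀ * t)) :
    (∀ μ : ℝ → Measure H, IsSC T μ →
      (∀ t : ℝ, 0 ≤ t → ∫ x, x ∂(μ t) = 0) →
      (∀ t : ℝ, 0 ≤ t → ∫⁻ x, (‖x‖₊ : ℝ≥0∞) ^ 2 ∂(μ t) < ⊤) →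
      IsDiffSC T μ) ↔
    (∀ x : ℝ → H, MemHt T x → ∃ x₀ : H, ∀ s : ℝ, 0 < s → x s = T s x₀) := by
  constructor
  · intro h x hx
    exact hx.closable hT hc₀ hb₀ hbd h
  · intro hcl μ hμ h0 h2
    obtain ⟨M, -, hTM⟩ := exists_norm_le_of_le_exp hc₀ hb₀ hbd 1
    obtain ⟨C, hC⟩ := exists_norm_sq_le_lintegral_orbit hT hTM hcl
    obtain ⟨K, hK, hm⟩ := hμ.lintegral_norm_sq_le hT h0 h2 hC
    exact hμ.isDiffSC hT hc₀ hb₀ hbd h0 hK hm
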